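/- arXiv:1108.2866 — 2 statements merged into one kernel-verified Lean document; each statement's English description precedes it below -/
import Mathlib

section
/- Let a ≥ 1 be an integer and let G = C_{3^a}^4 (the direct sum of four copies of the cyclic group of order 3^a). Then C_0(G) is nonempty. -/
/-- `S` contains a short zero-sum subsequence: a nonempty subsequence with sum `0`
whose length is at most `exp(G)`. -/
def HasShortZeroSumSubseq {G : Type*} [AddCommGroup G] (S : Multiset G) : Prop :=
  ∃ T, T ≤ S ∧ T.sum = 0 ∧ 1 ≤ Multiset.card T ∧ Multiset.card T ≤ AddMonoid.exponent G

/-- `η G` : the smallest `d` such that every sequence over `G` of length at least `d`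
contains a short zero-sum subsequence. -/
noncomputable def etaConst (G : Type*) [AddCommGroup G] : ℕ :=
  sInf {d : ℕ | ∀ S : Multiset G, d ≤ Multiset.card S → HasShortZeroSumSubseq S}

/-- `D G` : the Davenport constant, the smallest `d` such that every sequence over `G`
of length at least `d` contains a nonempty zero-sum subsequence. -/
noncomputable def davenport (G : Type*) [AddCommGroup G] : ℕ :=
  sInf {d : ℕ | ∀ S : Multiset G, d ≤ Multiset.card S → ∃ T, T ≤ S ∧ T ≠ 0 ∧ T.sum = 0}

/-- `C₀(G)` : the set of `t ∈ [D(G)+1, η(G)-1]` such that every zero-sum sequence over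
`G` of length exactly `t` contains a short zero-sum subsequence. -/
def C0 (G : Type*) [AddCommGroup G] : Set ℕ :=
  {t | davenport G + 1 ≤ t ∧ t ≤ etaConst G - 1 ∧
    ∀ S : Multiset G, Multiset.card S = t → S.sum = 0 → HasShortZeroSumSubseq S}

open Finset

/-- One representative of each pair `±f` of nonzero vectors. -/
def projReps : Finset (Fin 4 → ZMod 3) :=
  univ.filter fun f => f 0 = 1 ∨ f 0 = 0 ∧ (f 1 = 1 ∨ f 1 = 0 ∧ (f 2 = 1 ∨ f 2 = 0 ∧ f 3 = 1))

theorem card_projReps : #projReps = 40 := by decide +kernel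

theorem card_projReps_orth :
    ∀ u : Fin 4 → ZMod 3, u ≠ 0 → #{f ∈ projReps | f ⬝ᵥ u = 0} = 13 := by decide +kernel

theorem card_univ_orth :
    ∀ u : Fin 4 → ZMod 3, u ≠ 0 → #{f : Fin 4 → ZMod 3 | f ⬝ᵥ u = 0} = 27 := by decide +kernel

theorem sum_sq_le_nine {a b c : ℤ} (ha : 0 ≤ a) (hb : 0 ≤ b) (hc : 0 ≤ c) (ha' : a ≤ 2)
    (hb' : b ≤ 2) (hc' : c ≤ 2) (h : a + b + c = 5) : a ^ 2 + b ^ 2 + c ^ 2 ≤ 9 := by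
  obtain rfl : c = 5 - a - b := by omega
  interval_cases a <;> interval_cases b <;> omega

theorem sum_sq_le_thirty_six {a b c : ℤ} (ha : 0 ≤ a) (hb : 0 ≤ b) (hc : 0 ≤ c) (ha' : a ≤ 4)
    (hb' : b ≤ 4) (hc' : c ≤ 4) (h : a + b + c = 10) : a ^ 2 + b ^ 2 + c ^ 2 ≤ 36 := by
  obtain rfl : c = 10 - a - b := by omega
  interval_cases a <;> interval_cases b <;> omega

theorem moments_of_sum_eq_twenty_one {a b c : ℤ} (ha : 0 ≤ a) (hb : 0 ≤ b) (hc : 0 ≤ c)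
    (ha' : a ≤ 9) (hb' : b ≤ 9) (hc' : c ≤ 9) (h : a + b + c = 21) :
    19 * (a ^ 2 + b ^ 2 + c ^ 2) ≤ a ^ 3 + b ^ 3 + c ^ 3 + 1764 ∧
    (19 * (a ^ 2 + b ^ 2 + c ^ 2) = a ^ 3 + b ^ 3 + c ^ 3 + 1764 →
      24 ∣ a ^ 2 + b ^ 2 + c ^ 2 - 147) := by
  obtain rfl : c = 21 - a - b := by omega
  interval_cases a <;> interval_cases b <;> omega

theorem moments_of_sum_eq_twenty {a b c : ℤ} (ha : 0 ≤ a) (hb : 0 ≤ b) (hc : 0 ≤ c)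
    (ha' : a ≤ 9) (hb' : b ≤ 9) (hc' : c ≤ 9) (h : a + b + c = 20) (hbc : 3 ∣ b - c) :
    0 ≤ 1528 - 18 * (a ^ 2 + b ^ 2 + c ^ 2) + (a ^ 3 + b ^ 3 + c ^ 3) - 3 * a := by
  obtain rfl : c = 20 - a - b := by omega
  interval_cases a <;> interval_cases b <;> omega

/-- A subset of `𝔽₃⁴` without three distinct elements summing to `0`, i.e. without affine lines. -/
def IsCap (A : Finset (Fin 4 → ZMod 3)) : Prop :=
  ∀ x ∈ A, ∀ y ∈ A, ∀ z ∈ A, x ≠ y → x ≠ z → y ≠ z → x + y + z ≠ 0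

theorem IsCap.mono {A B : Finset (Fin 4 → ZMod 3)} (hA : IsCap A) (h : B ⊆ A) : IsCap B :=
  fun x hx y hy z hz => hA x (h hx) y (h hy) z (h hz)

/-- The number of elements of `A` on the affine hyperplane `f ⬝ᵥ x = j`, as an integer. -/
def sliceCard (A : Finset (Fin 4 → ZMod 3)) (f : Fin 4 → ZMod 3) (j : ZMod 3) : ℤ :=
  #{x ∈ A | f ⬝ᵥ x = j}

theorem sum_sliceCard (A : Finset (Fin 4 → ZMod 3)) (f : Fin 4 → ZMod 3) :
    ∑ j, sliceCard A f j = #A := by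
  unfold sliceCard
  rw [← Nat.cast_sum, ← Finset.card_eq_sum_card_fiberwise (fun _ _ => mem_coe.2 (mem_univ _))]

theorem sliceCard_nonneg (A : Finset (Fin 4 → ZMod 3)) (f : Fin 4 → ZMod 3) (j : ZMod 3) :
    0 ≤ sliceCard A f j := Nat.cast_nonneg _

theorem sliceCard_eq_sum (A : Finset (Fin 4 → ZMod 3)) (f : Fin 4 → ZMod 3) (j : ZMod 3) :
    sliceCard A f j = ∑ x ∈ A, if f ⬝ᵥ x = j then (1 : ℤ) else 0 := by
  simp [sliceCard]

section Counting

variable {R : Finset (Fin 4 → ZMod 3)} {p : ℕ}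

theorem three_mul_card_orth_pair
    (hR : ∀ u : Fin 4 → ZMod 3, u ≠ 0 → #{f ∈ R | f ⬝ᵥ u = 0} = p) {u v : Fin 4 → ZMod 3}
    (hu : u ≠ 0) (hv : v ≠ 0) (h₁ : u + v ≠ 0) (h₂ : u - v ≠ 0) :
    3 * #{f ∈ R | f ⬝ᵥ u = 0 ∧ f ⬝ᵥ v = 0} + #R = 4 * p := by
  have key : ∀ a b : ZMod 3, (if a = 0 then 1 else 0) + (if b = 0 then 1 else 0) +
      (if a + b = 0 then 1 else 0) + (if a - b = 0 then 1 else 0) =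
      3 * (if a = 0 ∧ b = 0 then 1 else 0) + 1 := by decide
  have h := Finset.sum_congr (rfl : R = R) fun f _ => key (f ⬝ᵥ u) (f ⬝ᵥ v)
  simp only [sum_add_distrib, ← mul_sum, ← dotProduct_add, ← dotProduct_sub] at h
  simp only [← card_filter, hR u hu, hR v hv, hR _ h₁, hR _ h₂, sum_const, smul_eq_mul,
    mul_one] at h
  omega

theorem sum_sliceCard_sq
    (hR : ∀ u : Fin 4 → ZMod 3, u ≠ 0 → #{f ∈ R | f ⬝ᵥ u = 0} = p)
    (A : Finset (Fin 4 → ZMod 3)) :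
    ∑ f ∈ R, ∑ j, sliceCard A f j ^ 2 = p * #A ^ 2 + (#R - p) * #A := by
  have h₁ : ∀ f ∈ R, ∑ j, sliceCard A f j ^ 2 =
      ∑ x ∈ A, ∑ y ∈ A, if f ⬝ᵥ (x - y) = 0 then (1 : ℤ) else 0 := by
    intro f _
    simp_rw [sliceCard_eq_sum, sq, sum_mul_sum]
    rw [sum_comm]
    refine sum_congr rfl fun x _ => ?_
    rw [sum_comm]
    refine sum_congr rfl fun y _ => ?_
    simp [dotProduct_sub, sub_eq_zero, eq_comm]
  have h₂ : ∀ x y : Fin 4 → ZMod 3, ∑ f ∈ R, (if f ⬝ᵥ (x - y) = 0 then (1 : ℤ) else 0) =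
      p + (#R - p) * if x = y then 1 else 0 := by
    intro x y
    rw [← Finset.natCast_card_filter]
    split_ifs with h
    · simp [h]
    · simp [hR _ (sub_ne_zero.2 h), -dotProduct_sub]
  rw [sum_congr rfl h₁, sum_comm]
  have h₃ : ∀ x ∈ A, ∑ f ∈ R, ∑ y ∈ A, (if f ⬝ᵥ (x - y) = 0 then (1 : ℤ) else 0) =
      p * #A + (#R - p) := by
    intro x hx
    rw [sum_comm]
    simp [h₂, sum_add_distrib, hx, mul_comm, -dotProduct_sub]
  rw [sum_congr rfl h₃]
  simp
  ring

theorem IsCap.three_mul_card_orth_sub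
    (hR : ∀ u : Fin 4 → ZMod 3, u ≠ 0 → #{f ∈ R | f ⬝ᵥ u = 0} = p)
    {A : Finset (Fin 4 → ZMod 3)} (hA : IsCap A) {x y z : Fin 4 → ZMod 3}
    (hx : x ∈ A) (hy : y ∈ A) (hz : z ∈ A) (hxy : x ≠ y) (hxz : x ≠ z) (hyz : y ≠ z) :
    3 * #{f ∈ R | f ⬝ᵥ (x - y) = 0 ∧ f ⬝ᵥ (x - z) = 0} + #R = 4 * p := by
  refine three_mul_card_orth_pair hR (sub_ne_zero.2 hxy) (sub_ne_zero.2 hxz) (fun h => ?_)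
    (fun h => hyz ?_)
  · refine hA x hx y hy z hz hxy hxz hyz ?_
    have h3 : (3 : ZMod 3) = 0 := rfl
    ext i
    have := congrFun h i
    simp only [Pi.add_apply, Pi.sub_apply, Pi.zero_apply] at this ⊢
    linear_combination -this + x i * h3
  · linear_combination -h

theorem IsCap.sum_sliceCard_cube {q : ℕ}
    (hR : ∀ u : Fin 4 → ZMod 3, u ≠ 0 → #{f ∈ R | f ⬝ᵥ u = 0} = p) (hq : 3 * q + #R = 4 * p)
    {A : Finset (Fin 4 → ZMod 3)} (hA : IsCap A) :
    ∑ f ∈ R, ∑ j, sliceCard A f j ^ 3 =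
      q * #A ^ 3 + 3 * (p - q) * #A ^ 2 + (#R + 2 * q - 3 * p) * #A := by
  have h₁ : ∀ f ∈ R, ∑ j, sliceCard A f j ^ 3 = ∑ x ∈ A, ∑ y ∈ A, ∑ z ∈ A,
      if f ⬝ᵥ (x - y) = 0 ∧ f ⬝ᵥ (x - z) = 0 then (1 : ℤ) else 0 := by
    intro f _
    have hcube : ∀ g : (Fin 4 → ZMod 3) → ℤ,
        (∑ x ∈ A, g x) ^ 3 = ∑ x ∈ A, ∑ y ∈ A, ∑ z ∈ A, g x * g y * g z := by
      intro g
      rw [pow_succ, sq, sum_mul_sum, sum_mul]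
      simp_rw [sum_mul, mul_sum]
    simp_rw [sliceCard_eq_sum, hcube]
    rw [sum_comm]
    refine sum_congr rfl fun x _ => ?_
    rw [sum_comm]
    refine sum_congr rfl fun y _ => ?_
    rw [sum_comm]
    refine sum_congr rfl fun z _ => ?_
    rw [Finset.sum_eq_single (f ⬝ᵥ x)]
    · simp only [dotProduct_sub, sub_eq_zero, eq_comm (a := f ⬝ᵥ x)]
      split_ifs <;> simp_all
    · intro j _ hj
      simp [hj.symm]
    · simp
  have h₂ : ∀ x ∈ A, ∀ y ∈ A, ∀ z ∈ A,
      ∑ f ∈ R, (if f ⬝ᵥ (x - y) = 0 ∧ f ⬝ᵥ (x - z) = 0 then (1 : ℤ) else 0) =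
      q + (p - q) * (if x = y then 1 else 0) + (p - q) * (if x = z then 1 else 0) +
        (p - q) * (if y = z then 1 else 0) +
        (#R + 2 * q - 3 * p) * if x = y then (if x = z then 1 else 0) else 0 := by
    intro x hx y hy z hz
    rw [← Finset.natCast_card_filter]
    by_cases hxy : x = y
    · subst hxy
      by_cases hxz : x = z
      · subst hxz
        simp
        ring
      · simp [hxz, hR _ (sub_ne_zero.2 hxz), -dotProduct_sub]
    · by_cases hxz : x = z
      · subst hxz
        simp [hxy, Ne.symm hxy, hR _ (sub_ne_zero.2 hxy), -dotProduct_sub]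
      · by_cases hyz : y = z
        · subst hyz
          simp [hxy, hR _ (sub_ne_zero.2 hxy), -dotProduct_sub]
        · have := hA.three_mul_card_orth_sub hR hx hy hz hxy hxz hyz
          have : #{f ∈ R | f ⬝ᵥ (x - y) = 0 ∧ f ⬝ᵥ (x - z) = 0} = q := by omega
          simp [hxy, hxz, hyz, this, -dotProduct_sub]
  rw [sum_congr rfl h₁, sum_comm]
  have h₃ : ∀ x ∈ A, ∑ f ∈ R, ∑ y ∈ A, ∑ z ∈ A,
      (if f ⬝ᵥ (x - y) = 0 ∧ f ⬝ᵥ (x - z) = 0 then (1 : ℤ) else 0) =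
      q * #A ^ 2 + 3 * (p - q) * #A + (#R + 2 * q - 3 * p) := by
    intro x hx
    rw [sum_comm]
    have h₄ : ∀ y ∈ A, ∑ f ∈ R, ∑ z ∈ A,
        (if f ⬝ᵥ (x - y) = 0 ∧ f ⬝ᵥ (x - z) = 0 then (1 : ℤ) else 0) =
        (q * #A + 2 * (p - q)) + (p - q) * #A * (if x = y then 1 else 0)
        + (#R + 2 * q - 3 * p) * if x = y then 1 else 0 := by
      intro y hy
      rw [sum_comm, sum_congr rfl (h₂ x hx y hy)]
      simp only [sum_add_distrib, ← mul_sum]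
      split_ifs <;> simp [hx, hy] <;> ring
    rw [sum_congr rfl h₄]
    simp only [sum_add_distrib, ← mul_sum]
    simp [hx]
    ring
  rw [sum_congr rfl h₃]
  simp
  ring

end Counting

/-- The linear forms that are constant on `B`. -/
def constForms (B : Finset (Fin 4 → ZMod 3)) : AddSubgroup (Fin 4 → ZMod 3) where
  carrier := {f | ∀ x ∈ B, ∀ y ∈ B, f ⬝ᵥ x = f ⬝ᵥ y}
  zero_mem' := by simp
  add_mem' hf hg x hx y hy := by
    rw [add_dotProduct, add_dotProduct, hf x hx y hy, hg x hx y hy]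
  neg_mem' hf x hx y hy := by
    rw [neg_dotProduct, neg_dotProduct, hf x hx y hy]

theorem constForms_anti {A B : Finset (Fin 4 → ZMod 3)} (h : B ⊆ A) :
    constForms A ≤ constForms B :=
  fun _ hf x hx y hy => hf x (h hx) y (h hy)

theorem card_constForms_mono {A B : Finset (Fin 4 → ZMod 3)} (h : B ⊆ A) :
    Nat.card (constForms A) ≤ Nat.card (constForms B) :=
  AddSubgroup.card_le_of_le (constForms_anti h)

theorem card_constForms (B : Finset (Fin 4 → ZMod 3)) :
    Nat.card (constForms B) = 1 ∨ Nat.card (constForms B) = 3 ∨ Nat.card (constForms B) = 9 ∨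
      Nat.card (constForms B) = 27 ∨ Nat.card (constForms B) = 81 := by
  have h := AddSubgroup.card_addSubgroup_dvd_card (constForms B)
  have h' : Nat.card (Fin 4 → ZMod 3) = 3 ^ 4 := by simp
  rw [h', Nat.dvd_prime_pow Nat.prime_three] at h
  obtain ⟨k, hk, h⟩ := h
  rw [h]
  interval_cases k <;> simp

theorem mem_constForms_slice (B : Finset (Fin 4 → ZMod 3)) (f : Fin 4 → ZMod 3) (j : ZMod 3) :
    f ∈ constForms {x ∈ B | f ⬝ᵥ x = j} := by
  intro x hx y hy
  rw [(mem_filter.1 hx).2, (mem_filter.1 hy).2]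

theorem three_mul_card_constForms_le {B : Finset (Fin 4 → ZMod 3)} {f : Fin 4 → ZMod 3}
    (hf : f ∉ constForms B) (j : ZMod 3) :
    3 * Nat.card (constForms B) ≤ Nat.card (constForms {x ∈ B | f ⬝ᵥ x = j}) := by
  set C := {x ∈ B | f ⬝ᵥ x = j} with hC
  have hsmul : ∀ c : ZMod 3, c • f ∈ constForms C := by
    intro c x hx y hy
    rw [smul_dotProduct, smul_dotProduct, mem_constForms_slice B f j x hx y hy]
  let F : ZMod 3 × constForms B → constForms C := fun a =>
    ⟨a.1 • f + a.2, add_mem (hsmul a.1) (constForms_anti (filter_subset _ _) a.2.2)⟩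
  have hF : Function.Injective F := by
    rintro ⟨c, k⟩ ⟨d, l⟩ h
    have h' : c • f + (k : Fin 4 → ZMod 3) = d • f + l := congrArg Subtype.val h
    have hcd : c = d := by
      by_contra hne
      refine hf fun x hx y hy => ?_
      have h₁ := congrArg (· ⬝ᵥ x) h'
      have h₂ := congrArg (· ⬝ᵥ y) h'
      simp only [add_dotProduct, smul_dotProduct, smul_eq_mul] at h₁ h₂
      have hk := k.2 x hx y hy
      have hl := l.2 x hx y hy
      have : (c - d) * (f ⬝ᵥ x - f ⬝ᵥ y) = 0 := by linear_combination h₁ - h₂ - hk + hl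
      rcases mul_eq_zero.1 this with h | h
      · exact absurd (sub_eq_zero.1 h) hne
      · exact sub_eq_zero.1 h
    subst hcd
    exact Prod.ext rfl (Subtype.ext (add_left_cancel h'))
  have := Nat.card_le_card_of_injective F hF
  simpa [Nat.card_prod] using this

/-- Averaging the second moment over all linear forms not constant on `A`. -/
theorem sum_sq_le_of_slices {A : Finset (Fin 4 → ZMod 3)} {M : ℤ}
    (hM : ∀ f ∉ constForms A, ∑ j, sliceCard A f j ^ 2 ≤ M) :
    27 * (#A : ℤ) ^ 2 + 54 * #A ≤
      Nat.card (constForms A) * (#A : ℤ) ^ 2 + (81 - Nat.card (constForms A)) * M := by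
  classical
  have h := sum_sliceCard_sq (R := univ) (fun u hu => card_univ_orth u hu) A
  have hle : ∀ f : Fin 4 → ZMod 3, ∑ j, sliceCard A f j ^ 2 ≤
      M + (#A ^ 2 - M) * if f ∈ constForms A then 1 else 0 := by
    intro f
    split_ifs with hf
    · have h₁ : ∑ j, sliceCard A f j ^ 2 ≤ (∑ j, sliceCard A f j) ^ 2 :=
        Finset.sum_sq_le_sq_sum_of_nonneg fun j _ => sliceCard_nonneg A f j
      rw [sum_sliceCard] at h₁
      linarith
    · linarith [hM f hf]
  have h₂ := Finset.sum_le_sum fun f (_ : f ∈ univ) => hle f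
  rw [h, sum_add_distrib, ← mul_sum, ← Finset.natCast_card_filter] at h₂
  have hK : Nat.card (constForms A) = #{f | f ∈ constForms A} := by
    rw [Nat.card_eq_fintype_card]
    exact Fintype.card_subtype _
  rw [hK]
  simp only [card_univ, sum_const, Fintype.card_pi, ZMod.card, prod_const, Fintype.card_fin,
    nsmul_eq_mul] at h₂
  norm_num at h₂
  linarith

theorem IsCap.card_le_two {A : Finset (Fin 4 → ZMod 3)} (hA : IsCap A)
    (hK : 27 ≤ Nat.card (constForms A)) : #A ≤ 2 := by
  classical
  by_contra! h
  obtain ⟨x, y, z, hx, hy, hz, hxy, hxz, hyz⟩ := Finset.two_lt_card_iff.1 h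
  have h₁ := hA.three_mul_card_orth_sub (R := univ) (fun u hu => card_univ_orth u hu)
    hx hy hz hxy hxz hyz
  have h₂ : Nat.card (constForms A) ≤
      #{f : Fin 4 → ZMod 3 | f ⬝ᵥ (x - y) = 0 ∧ f ⬝ᵥ (x - z) = 0} := by
    rw [Nat.card_eq_fintype_card, Fintype.card_subtype]
    refine card_le_card fun f hf => ?_
    have hf := (mem_filter.1 hf).2
    simp [dotProduct_sub, sub_eq_zero, ← hf x hx y hy, ← hf x hx z hz]
  simp only [card_univ, Fintype.card_pi, ZMod.card, prod_const, Fintype.card_fin] at h₁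
  omega

theorem IsCap.sliceCard_le {A : Finset (Fin 4 → ZMod 3)} {k s : ℕ} (hA : IsCap A)
    (hs : ∀ B, IsCap B → 3 * k ≤ Nat.card (constForms B) → #B ≤ s)
    (hK : k ≤ Nat.card (constForms A)) {f : Fin 4 → ZMod 3} (hf : f ∉ constForms A)
    (j : ZMod 3) : sliceCard A f j ≤ s := by
  have := three_mul_card_constForms_le hf j
  exact Nat.cast_le.2 (hs _ (hA.mono (filter_subset _ _)) (by omega))

theorem sum_zmod_three (g : ZMod 3 → ℤ) : ∑ j, g j = g 0 + g 1 + g 2 := Fin.sum_univ_three g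

theorem IsCap.card_le_four {A : Finset (Fin 4 → ZMod 3)} (hA : IsCap A)
    (hK : 9 ≤ Nat.card (constForms A)) : #A ≤ 4 := by
  by_contra! h
  obtain ⟨B, hBA, hB⟩ := Finset.exists_subset_card_eq (Nat.succ_le_of_lt h)
  have hcap := hA.mono hBA
  have hKB := hK.trans (card_constForms_mono hBA)
  have h27 : ¬ 27 ≤ Nat.card (constForms B) := fun h' => by
    have := hcap.card_le_two h'
    omega
  have h9 : Nat.card (constForms B) = 9 := by
    have := card_constForms B
    omega
  have := sum_sq_le_of_slices (A := B) (M := 9) fun f hf => by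
    have hle := hcap.sliceCard_le (k := 9) (s := 2) (fun C hC => hC.card_le_two) hKB hf
    have hsum := sum_sliceCard B f
    have h0 := sliceCard_nonneg B f
    rw [sum_zmod_three, hB] at hsum
    rw [sum_zmod_three]
    exact sum_sq_le_nine (h0 0) (h0 1) (h0 2) (hle 0) (hle 1) (hle 2) hsum
  rw [h9, hB] at this
  norm_num at this

theorem IsCap.card_le_nine {A : Finset (Fin 4 → ZMod 3)} (hA : IsCap A)
    (hK : 3 ≤ Nat.card (constForms A)) : #A ≤ 9 := by
  by_contra! h
  obtain ⟨B, hBA, hB⟩ := Finset.exists_subset_card_eq (Nat.succ_le_of_lt h)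
  have hcap := hA.mono hBA
  have hKB := hK.trans (card_constForms_mono hBA)
  have h9 : ¬ 9 ≤ Nat.card (constForms B) := fun h' => by
    have := hcap.card_le_four h'
    omega
  have h3 : Nat.card (constForms B) = 3 := by
    have := card_constForms B
    omega
  have := sum_sq_le_of_slices (A := B) (M := 36) fun f hf => by
    have hle := hcap.sliceCard_le (k := 3) (s := 4) (fun C hC => hC.card_le_four) hKB hf
    have hsum := sum_sliceCard B f
    have h0 := sliceCard_nonneg B f
    rw [sum_zmod_three, hB] at hsum
    rw [sum_zmod_three]
    exact sum_sq_le_thirty_six (h0 0) (h0 1) (h0 2) (hle 0) (hle 1) (hle 2) hsum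
  rw [h3, hB] at this
  norm_num at this

theorem IsCap.sliceCard_le_nine {A : Finset (Fin 4 → ZMod 3)} (hA : IsCap A)
    {f : Fin 4 → ZMod 3} (hf : f ≠ 0) (j : ZMod 3) : sliceCard A f j ≤ 9 := by
  refine Nat.cast_le.2 ((hA.mono (filter_subset _ _)).card_le_nine ?_)
  have h₁ : Nat.card (constForms {x ∈ A | f ⬝ᵥ x = j}) ≠ 1 := fun h => by
    have h' := mem_constForms_slice A f j
    rw [AddSubgroup.card_eq_one.1 h] at h'
    exact hf h'
  have := card_constForms {x ∈ A | f ⬝ᵥ x = j}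
  omega

theorem ne_zero_of_mem_projReps {f : Fin 4 → ZMod 3} (hf : f ∈ projReps) : f ≠ 0 := by
  rintro rfl
  simp [projReps] at hf

theorem IsCap.card_le_twenty {A : Finset (Fin 4 → ZMod 3)} (hA : IsCap A) : #A ≤ 20 := by
  by_contra! h
  obtain ⟨B, hBA, hB⟩ := Finset.exists_subset_card_eq (Nat.succ_le_of_lt h)
  have hcap := hA.mono hBA
  have h₂ := sum_sliceCard_sq card_projReps_orth B
  have h₃ := hcap.sum_sliceCard_cube (q := 4) card_projReps_orth (by rw [card_projReps])
  rw [card_projReps, hB] at h₂ h₃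
  have key : ∀ f ∈ projReps,
      19 * ∑ j, sliceCard B f j ^ 2 ≤ ∑ j, sliceCard B f j ^ 3 + 1764 ∧
      (19 * ∑ j, sliceCard B f j ^ 2 = ∑ j, sliceCard B f j ^ 3 + 1764 →
        24 ∣ ∑ j, sliceCard B f j ^ 2 - 147) := by
    intro f hf
    have hle := hcap.sliceCard_le_nine (ne_zero_of_mem_projReps hf)
    have hsum := sum_sliceCard B f
    have h0 := sliceCard_nonneg B f
    rw [sum_zmod_three, hB] at hsum
    rw [sum_zmod_three, sum_zmod_three]
    exact moments_of_sum_eq_twenty_one (h0 0) (h0 1) (h0 2) (hle 0) (hle 1) (hle 2) hsum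
  have heq := (sum_eq_sum_iff_of_le fun f hf => (key f hf).1).1 (by
    rw [← mul_sum, h₂, sum_add_distrib, h₃, sum_const, card_projReps]
    norm_num)
  have hdvd := dvd_sum fun f hf => (key f hf).2 (heq f hf)
  rw [sum_sub_distrib, h₂, sum_const, card_projReps] at hdvd
  norm_num at hdvd

theorem sum_sliceCard_zero {A : Finset (Fin 4 → ZMod 3)} (h0 : 0 ∈ A) :
    ∑ f ∈ projReps, sliceCard A f 0 = 27 + 13 * #A := by
  simp_rw [sliceCard_eq_sum]
  rw [sum_comm, ← add_sum_erase _ _ h0]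
  have : ∀ x ∈ A.erase 0, ∑ f ∈ projReps, (if f ⬝ᵥ x = 0 then (1 : ℤ) else 0) = 13 := by
    intro x hx
    rw [← natCast_card_filter, card_projReps_orth x (ne_of_mem_erase hx)]
    rfl
  rw [sum_congr rfl this]
  have := card_erase_add_one h0
  simp [card_projReps]
  omega

theorem sliceCard_one_modEq {A : Finset (Fin 4 → ZMod 3)} (hsum : ∑ x ∈ A, x = 0)
    (f : Fin 4 → ZMod 3) : (3 : ℤ) ∣ sliceCard A f 1 - sliceCard A f 2 := by
  have h : ∑ x ∈ A, f ⬝ᵥ x = 0 := by rw [← dotProduct_sum, hsum, dotProduct_zero]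
  refine (ZMod.intCast_zmod_eq_zero_iff_dvd _ 3).1 ?_
  have h' : ∀ a : ZMod 3, (((if a = 1 then 1 else 0) - if a = 2 then 1 else 0 : ℤ) : ZMod 3) = a := by
    decide
  rw [sliceCard_eq_sum, sliceCard_eq_sum, ← sum_sub_distrib, Int.cast_sum, ← h]
  exact sum_congr rfl fun x _ => h' _

/-- The point `c` around which a `20`-cap is symmetric is not on the cap; here `c = 0`. -/
theorem IsCap.card_ne_twenty {A : Finset (Fin 4 → ZMod 3)} (hA : IsCap A) (h0 : 0 ∈ A)
    (hsum : ∑ x ∈ A, x = 0) : #A ≠ 20 := by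
  intro hcard
  have h₁ := sum_sliceCard_zero h0
  have h₂ := sum_sliceCard_sq card_projReps_orth A
  have h₃ := hA.sum_sliceCard_cube (q := 4) card_projReps_orth (by rw [card_projReps])
  rw [card_projReps, hcard] at h₂ h₃
  have key : ∀ f ∈ projReps, 0 ≤ 1528 - 18 * ∑ j, sliceCard A f j ^ 2 +
      ∑ j, sliceCard A f j ^ 3 - 3 * sliceCard A f 0 := by
    intro f hf
    have hle := hA.sliceCard_le_nine (ne_zero_of_mem_projReps hf)
    have hs := sum_sliceCard A f
    have h0 := sliceCard_nonneg A f
    rw [sum_zmod_three, hcard] at hs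
    rw [sum_zmod_three, sum_zmod_three]
    exact moments_of_sum_eq_twenty (h0 0) (h0 1) (h0 2) (hle 0) (hle 1) (hle 2) hs
      (sliceCard_one_modEq hsum f)
  have := sum_nonneg key
  rw [sum_sub_distrib, sum_add_distrib, sum_sub_distrib, ← mul_sum, ← mul_sum, h₁, h₂, h₃, hcard,
    sum_const, card_projReps] at this
  norm_num at this

theorem Multiset.exists_le_map_eq {α β : Type*} {f : α → β} {S : Multiset α} {T : Multiset β}
    (h : T ≤ S.map f) : ∃ T' ≤ S, T'.map f = T := by
  have h' := Multiset.mem_powersetCard.2 ⟨h, rfl⟩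
  rw [Multiset.powersetCard_map, Multiset.mem_map] at h'
  obtain ⟨T', hT', rfl⟩ := h'
  exact ⟨T', (Multiset.mem_powersetCard.1 hT').1, rfl⟩

theorem exponent_fin_four_zmod (n : ℕ) : AddMonoid.exponent (Fin 4 → ZMod n) = n := by
  refine Nat.dvd_antisymm ?_ ?_
  · rw [AddMonoid.exponent_pi]
    exact Finset.lcm_dvd fun i _ => (ZMod.exponent n).dvd
  · have := AddMonoidHom.exponent_dvd (f := Pi.evalAddMonoidHom (fun _ : Fin 4 => ZMod n) 0)
      (Function.surjective_eval 0)
    rwa [ZMod.exponent] at this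

section ThreeTorsion

variable {S : Multiset (Fin 4 → ZMod 3)}

theorem zero_notMem_of_not_hasShort (hS : ¬ HasShortZeroSumSubseq S) : 0 ∉ S := fun h =>
  hS ⟨{0}, Multiset.singleton_le.2 h, by simp, by simp, by simp [exponent_fin_four_zmod]⟩

theorem count_le_two_of_not_hasShort (hS : ¬ HasShortZeroSumSubseq S) (x : Fin 4 → ZMod 3) :
    S.count x ≤ 2 := by
  by_contra! h
  refine hS ⟨Multiset.replicate 3 x, Multiset.le_count_iff_replicate_le.1 h, ?_, by simp,
    by simp [exponent_fin_four_zmod]⟩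
  rw [Multiset.sum_replicate]
  ext i
  simpa using (by decide : ∀ a : ZMod 3, 3 * a = 0) (x i)

theorem isCap_of_not_hasShort (hS : ¬ HasShortZeroSumSubseq S) :
    IsCap (insert 0 S.toFinset) := by
  intro x hx y hy z hz hxy hxz hyz h
  have hcard : #({x, y, z} : Finset (Fin 4 → ZMod 3)) = 3 :=
    card_eq_three.2 ⟨x, y, z, hxy, hxz, hyz, rfl⟩
  refine hS ⟨(({x, y, z} : Finset (Fin 4 → ZMod 3)).erase 0).val,
    (Multiset.le_iff_subset (Finset.nodup _)).2 fun w hw => ?_, ?_, ?_, ?_⟩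
  · have hw := Finset.mem_erase.1 (Finset.mem_def.2 hw)
    have hw' : w ∈ insert 0 S.toFinset := by
      have := hw.2
      simp only [mem_insert, mem_singleton] at this
      rcases this with rfl | rfl | rfl <;> assumption
    simpa [hw.1] using hw'
  · rw [Finset.sum_val, Finset.sum_erase (f := id) _ rfl, Finset.sum_insert (by simp [hxy, hxz]),
      Finset.sum_pair hyz, ← h]
    exact (add_assoc x y z).symm
  · have := pred_card_le_card_erase (s := ({x, y, z} : Finset (Fin 4 → ZMod 3))) (a := 0)
    rw [Finset.card_val]
    omega
  · rw [Finset.card_val, exponent_fin_four_zmod]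
    exact card_erase_le.trans hcard.le

theorem card_toFinset_le_of_not_hasShort (hS : ¬ HasShortZeroSumSubseq S) :
    #S.toFinset ≤ 19 := by
  have h := (isCap_of_not_hasShort hS).card_le_twenty
  rw [card_insert_of_notMem (by simpa using zero_notMem_of_not_hasShort hS)] at h
  omega

theorem hasShort_of_card_ge (h : 39 ≤ Multiset.card S) : HasShortZeroSumSubseq S := by
  by_contra hS
  have h₁ := sum_le_card_nsmul S.toFinset _ _ fun x _ => count_le_two_of_not_hasShort hS x
  rw [Multiset.toFinset_sum_count_eq, smul_eq_mul] at h₁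
  have := card_toFinset_le_of_not_hasShort hS
  omega

theorem hasShort_of_card_eq (h : Multiset.card S = 38) (h₀ : S.sum = 0) :
    HasShortZeroSumSubseq S := by
  by_contra hS
  have hle := fun x (_ : x ∈ S.toFinset) => count_le_two_of_not_hasShort hS x
  have h₁ := sum_le_card_nsmul S.toFinset _ _ hle
  rw [Multiset.toFinset_sum_count_eq, smul_eq_mul] at h₁
  have h₂ := card_toFinset_le_of_not_hasShort hS
  have h₃ : ∀ x ∈ S.toFinset, S.count x = 2 := by
    refine (sum_eq_sum_iff_of_le hle).1 ?_
    rw [Multiset.toFinset_sum_count_eq, sum_const, smul_eq_mul]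
    omega
  have h₄ : ∑ x ∈ S.toFinset, x = 0 := by
    rw [Finset.sum_multiset_count, sum_congr rfl fun x hx => by rw [h₃ x hx], ← smul_sum] at h₀
    ext i
    have := congrFun h₀ i
    exact (by decide : ∀ a : ZMod 3, 2 • a = 0 → a = 0) _ this
  have h₅ := zero_notMem_of_not_hasShort hS
  refine (isCap_of_not_hasShort hS).card_ne_twenty (mem_insert_self _ _) ?_ ?_
  · rw [sum_insert (by simpa using h₅), h₄, add_zero]
  · rw [card_insert_of_notMem (by simpa using h₅)]
    omega

end ThreeTorsion

/-- An integral version of `HasShortZeroSumSubseq` for `C_n ^ 4`. -/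
def HasShortZeroSumMod (n : ℕ) (S : Multiset (Fin 4 → ℤ)) : Prop :=
  ∃ T ≤ S, T ≠ 0 ∧ Multiset.card T ≤ n ∧ ∀ i, (n : ℤ) ∣ T.sum i

/-- Coordinatewise reduction modulo `n`. -/
def reduceMod (n : ℕ) : (Fin 4 → ℤ) →+ (Fin 4 → ZMod n) :=
  (Int.castAddHom (ZMod n)).compLeft (Fin 4)

theorem reduceMod_eq_zero {n : ℕ} {v : Fin 4 → ℤ} :
    reduceMod n v = 0 ↔ ∀ i, (n : ℤ) ∣ v i := by
  rw [funext_iff]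
  exact forall_congr' fun i => ZMod.intCast_zmod_eq_zero_iff_dvd _ _

theorem reduceMod_surjective (n : ℕ) : Function.Surjective (reduceMod n) :=
  Function.Surjective.comp_left (g := (Int.cast : ℤ → ZMod n)) ZMod.intCast_surjective

theorem hasShort_map_reduceMod {n : ℕ} {S : Multiset (Fin 4 → ℤ)} :
    HasShortZeroSumSubseq (S.map (reduceMod n)) ↔ HasShortZeroSumMod n S := by
  constructor
  · rintro ⟨T, hT, h₀, h₁, h₂⟩
    obtain ⟨T, hTS, rfl⟩ := Multiset.exists_le_map_eq hT
    rw [← map_multiset_sum, reduceMod_eq_zero] at h₀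
    rw [Multiset.card_map] at h₁ h₂
    rw [exponent_fin_four_zmod] at h₂
    exact ⟨T, hTS, Multiset.card_pos.1 h₁, h₂, h₀⟩
  · rintro ⟨T, hT, h₁, h₂, h₀⟩
    refine ⟨T.map (reduceMod n), Multiset.map_le_map hT, ?_, ?_, ?_⟩
    · rwa [← map_multiset_sum, reduceMod_eq_zero]
    · rwa [Multiset.card_map, Nat.succ_le_iff, Multiset.card_pos]
    · rwa [Multiset.card_map, exponent_fin_four_zmod]

theorem hasShortZeroSumMod_three_of_card_ge {S : Multiset (Fin 4 → ℤ)}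
    (h : 39 ≤ Multiset.card S) : HasShortZeroSumMod 3 S :=
  hasShort_map_reduceMod.1 (hasShort_of_card_ge (by rwa [Multiset.card_map]))

theorem hasShortZeroSumMod_three_of_card_eq {S : Multiset (Fin 4 → ℤ)}
    (h : Multiset.card S = 38) (h₀ : ∀ i, 3 ∣ S.sum i) : HasShortZeroSumMod 3 S := by
  refine hasShort_map_reduceMod.1 (hasShort_of_card_eq (by rwa [Multiset.card_map]) ?_)
  rwa [← map_multiset_sum, reduceMod_eq_zero]

/-- `L` is a family of disjoint nonempty subsequences of `S` of length at most `3`, each with sum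
divisible by `3`. -/
def IsShortFamily (S : Multiset (Fin 4 → ℤ)) (L : Multiset (Multiset (Fin 4 → ℤ))) : Prop :=
  L.sum ≤ S ∧ ∀ T ∈ L, T ≠ 0 ∧ Multiset.card T ≤ 3 ∧ ∀ i, (3 : ℤ) ∣ T.sum i

theorem Multiset.card_sum_le {α : Type*} {L : Multiset (Multiset α)} {m : ℕ}
    (h : ∀ T ∈ L, Multiset.card T ≤ m) : Multiset.card L.sum ≤ Multiset.card L * m := by
  rw [← Multiset.join, Multiset.card_join, ← smul_eq_mul, ← Multiset.card_map Multiset.card L]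
  exact Multiset.sum_le_card_nsmul _ _ fun x hx => by
    obtain ⟨T, hT, rfl⟩ := Multiset.mem_map.1 hx
    exact h T hT

theorem Multiset.sum_sum_eq {M : Type*} [AddCommMonoid M] (L : Multiset (Multiset M)) :
    L.sum.sum = (L.map Multiset.sum).sum :=
  map_multiset_sum Multiset.sumAddMonoidHom L

theorem IsShortFamily.cons {S : Multiset (Fin 4 → ℤ)} {L : Multiset (Multiset (Fin 4 → ℤ))}
    (hL : IsShortFamily S L) (h : HasShortZeroSumMod 3 (S - L.sum)) :
    ∃ T, IsShortFamily S (T ::ₘ L) := by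
  obtain ⟨T, hT, h₁, h₂, h₃⟩ := h
  refine ⟨T, ?_, ?_⟩
  · rw [Multiset.sum_cons]
    exact (add_le_add_left hT _).trans (Multiset.sub_add_cancel hL.1).le
  · intro U hU
    rcases Multiset.mem_cons.1 hU with rfl | hU
    · exact ⟨h₁, h₂, h₃⟩
    · exact hL.2 U hU

theorem exists_isShortFamily {S : Multiset (Fin 4 → ℤ)} (k : ℕ)
    (hS : k = 0 ∨ 3 * k + 36 ≤ Multiset.card S) :
    ∃ L, IsShortFamily S L ∧ Multiset.card L = k := by
  induction k with
  | zero => exact ⟨0, ⟨by simp, by simp⟩, rfl⟩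
  | succ k ih =>
    obtain ⟨L, hL, hk⟩ := ih (by omega)
    have hcard := Multiset.card_sum_le fun T hT => (hL.2 T hT).2.1
    obtain ⟨T, hT⟩ := hL.cons (hasShortZeroSumMod_three_of_card_ge (by
      rw [Multiset.card_sub hL.1]
      omega))
    exact ⟨T ::ₘ L, hT, by rw [Multiset.card_cons, hk]⟩

theorem IsShortFamily.hasShortZeroSumMod {n : ℕ} {S : Multiset (Fin 4 → ℤ)}
    {L : Multiset (Multiset (Fin 4 → ℤ))} (hL : IsShortFamily S L)
    (h : HasShortZeroSumMod n (L.map fun T i => T.sum i / 3)) : HasShortZeroSumMod (3 * n) S := by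
  obtain ⟨M, hM, h₁, h₂, h₃⟩ := h
  obtain ⟨M, hML, rfl⟩ := Multiset.exists_le_map_eq hM
  have hmem : ∀ T ∈ M, T ≠ 0 ∧ Multiset.card T ≤ 3 ∧ ∀ i, (3 : ℤ) ∣ T.sum i :=
    fun T hT => hL.2 T (Multiset.mem_of_le hML hT)
  refine ⟨M.sum, ?_, ?_, ?_, fun i => ?_⟩
  · refine le_trans ?_ hL.1
    obtain ⟨N, rfl⟩ := Multiset.le_iff_exists_add.1 hML
    rw [Multiset.sum_add]
    exact Multiset.le_add_right _ _
  · intro h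
    obtain ⟨T, hT⟩ := Multiset.exists_mem_of_ne_zero fun h' : M = 0 => h₁ (by rw [h']; rfl)
    exact (hmem T hT).1 (le_zero_iff.1 (h ▸ Multiset.le_sum_of_mem hT))
  · rw [Multiset.card_map] at h₂
    have := Multiset.card_sum_le fun T hT => (hmem T hT).2.1
    omega
  · have hsum : M.sum.sum i = 3 * (M.map fun T i => T.sum i / 3 : Multiset (Fin 4 → ℤ)).sum i := by
      rw [Multiset.sum_sum_eq, ← Pi.evalAddMonoidHom_apply (fun _ => ℤ) i (Multiset.sum _),
        ← Pi.evalAddMonoidHom_apply (fun _ => ℤ) i (Multiset.sum (Multiset.map _ M)),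
        map_multiset_sum, map_multiset_sum, Multiset.map_map, Multiset.map_map,
        ← Multiset.sum_map_mul_left]
      refine congrArg _ (Multiset.map_congr rfl fun T hT => ?_)
      simpa using (Int.mul_ediv_cancel' ((hmem T hT).2.2 i)).symm
    rw [hsum]
    push_cast
    exact mul_dvd_mul_left _ (h₃ i)

theorem hasShortZeroSumMod_of_card_ge (a : ℕ) {S : Multiset (Fin 4 → ℤ)}
    (h : 19 * 3 ^ a ≤ Multiset.card S + 18) : HasShortZeroSumMod (3 ^ a) S := by
  induction a generalizing S with
  | zero =>
    obtain ⟨x, hx⟩ := Multiset.card_pos_iff_exists_mem.1 (by omega : 0 < Multiset.card S)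
    exact ⟨{x}, Multiset.singleton_le.2 hx, by simp, by simp, by simp⟩
  | succ a ih =>
    have hpos := Nat.one_le_pow a 3 (by norm_num)
    obtain ⟨L, hL, hk⟩ := exists_isShortFamily (S := S) (19 * 3 ^ a - 18) (by omega)
    rw [pow_succ']
    exact hL.hasShortZeroSumMod (ih (by rw [Multiset.card_map]; omega))

theorem hasShortZeroSumMod_of_card_eq {a : ℕ} (ha : 1 ≤ a) {S : Multiset (Fin 4 → ℤ)}
    (h : Multiset.card S + 19 = 19 * 3 ^ a) (h₀ : ∀ i, ((3 ^ a : ℕ) : ℤ) ∣ S.sum i) :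
    HasShortZeroSumMod (3 ^ a) S := by
  obtain ⟨a, rfl⟩ := Nat.exists_eq_add_of_le' ha
  have hpos := Nat.one_le_pow a 3 (by norm_num)
  rw [pow_succ'] at *
  obtain ⟨L, hL, hk⟩ := exists_isShortFamily (S := S) (19 * 3 ^ a - 19) (by omega)
  have hcard := Multiset.card_sum_le fun T hT => (hL.2 T hT).2.1
  have hsub := Multiset.card_sub hL.1
  have hrest : HasShortZeroSumMod 3 (S - L.sum) := by
    by_cases h39 : 39 ≤ Multiset.card (S - L.sum)
    · exact hasShortZeroSumMod_three_of_card_ge h39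
    · refine hasShortZeroSumMod_three_of_card_eq (by omega) fun i => ?_
      have h₁ : (S - L.sum).sum + L.sum.sum = S.sum := by
        rw [← Multiset.sum_add, Multiset.sub_add_cancel hL.1]
      have h₂ : (3 : ℤ) ∣ S.sum i := (Dvd.intro (3 ^ a : ℤ) (by push_cast; rfl)).trans (h₀ i)
      have h₃ : (3 : ℤ) ∣ L.sum.sum i := by
        rw [Multiset.sum_sum_eq, ← Pi.evalAddMonoidHom_apply (fun _ => ℤ) i (Multiset.sum _),
          map_multiset_sum, Multiset.map_map]
        refine Multiset.dvd_sum fun x hx => ?_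
        obtain ⟨T, hT, rfl⟩ := Multiset.mem_map.1 hx
        exact (hL.2 T hT).2.2 i
      rw [← h₁, Pi.add_apply] at h₂
      exact (dvd_add_left h₃).1 h₂
  obtain ⟨T, hT⟩ := hL.cons hrest
  exact hT.hasShortZeroSumMod (hasShortZeroSumMod_of_card_ge a (by
    rw [Multiset.card_map, Multiset.card_cons]
    omega))

/-- Ten antipodal pairs in `{-1, 0, 1}⁴` which form a `20`-cap modulo `3`; all coordinate sums
are odd. -/
def capPoints : Fin 20 → Fin 4 → ℤ :=
  ![![0, 0, 0, 1], ![0, 0, 1, 0], ![0, 1, -1, -1], ![0, 1, 0, 0], ![1, -1, 0, 1],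
    ![1, -1, 1, 0], ![1, 0, -1, -1], ![1, 0, 1, 1], ![1, 1, -1, 0], ![1, 1, 0, -1],
    ![0, 0, 0, -1], ![0, 0, -1, 0], ![0, -1, 1, 1], ![0, -1, 0, 0], ![-1, 1, 0, -1],
    ![-1, 1, -1, 0], ![-1, 0, 1, 1], ![-1, 0, -1, -1], ![-1, -1, 1, 0], ![-1, -1, 0, 1]]

theorem capPoints_mem (i : Fin 20) (j : Fin 4) :
    capPoints i j = -1 ∨ capPoints i j = 0 ∨ capPoints i j = 1 := by
  revert i j; decide

theorem two_dvd_sum_capPoints_sub_one (i : Fin 20) : (2 : ℤ) ∣ ∑ j, capPoints i j - 1 := by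
  revert i; decide

theorem capPoints_eq_of_eq_off :
    ∀ i i' : Fin 20, ∀ k : Fin 4, (∀ j, j ≠ k → capPoints i j ≠ 0) →
      (∀ j, j ≠ k → capPoints i j = capPoints i' j) → i = i' := by
  decide +kernel

theorem exists_unique_coordinate {v : Fin 4 → ℤ} (hv : ∀ j, v j = -1 ∨ v j = 0 ∨ v j = 1)
    (hodd : ¬ (2 : ℤ) ∣ ∑ j, v j) :
    ∃ k, (∀ j, j ≠ k → v j ≠ 0) ∨ v k ≠ 0 ∧ ∀ j, j ≠ k → v j = 0 := by
  have key : ∀ g : Fin 4 → Fin 3, ¬ (2 : ℤ) ∣ ∑ j, ((g j : ℕ) - 1 : ℤ) →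
      ∃ k, (∀ j, j ≠ k → ((g j : ℕ) - 1 : ℤ) ≠ 0) ∨
        ((g k : ℕ) - 1 : ℤ) ≠ 0 ∧ ∀ j, j ≠ k → ((g j : ℕ) - 1 : ℤ) = 0 := by
    decide +kernel
  have hg : ∀ j, ∃ g : Fin 3, v j = (g : ℕ) - 1 := fun j => by
    rcases hv j with h | h | h
    · exact ⟨0, h⟩
    · exact ⟨1, h⟩
    · exact ⟨2, h⟩
  choose g hg using hg
  obtain rfl : v = fun j => ((g j : ℕ) - 1 : ℤ) := funext hg
  exact key g hodd

/-- A weighted average of the cap points with odd total weight is a lattice point only if it is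
one of the cap points. -/
theorem capPoints_no_lattice_average {n : ℤ} (hn : ¬ (2 : ℤ) ∣ n) {c : Fin 20 → ℤ}
    (h0 : ∀ i, 0 ≤ c i) (hc : ∀ i, c i < n) (hsum : ∑ i, c i = n)
    (hdvd : ∀ j, n ∣ ∑ i, c i * capPoints i j) : False := by
  choose v hv using hdvd
  have hpos : 0 < n := (h0 0).trans_lt (hc 0)
  have habs : ∀ i j, |capPoints i j| ≤ 1 := fun i j => by
    rcases capPoints_mem i j with h | h | h <;> simp [h]
  have hv1 : ∀ j, v j = -1 ∨ v j = 0 ∨ v j = 1 := by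
    intro j
    have : |∑ i, c i * capPoints i j| ≤ n := by
      rw [← hsum]
      refine (abs_sum_le_sum_abs _ _).trans (sum_le_sum fun i _ => ?_)
      rw [abs_mul, abs_of_nonneg (h0 i)]
      exact mul_le_of_le_one_right (h0 i) (habs i j)
    rw [hv, abs_mul, abs_of_pos hpos] at this
    have : |v j| ≤ 1 := by nlinarith
    rw [abs_le] at this
    omega
  have hface : ∀ j, v j ≠ 0 → ∀ i, capPoints i j ≠ v j → c i = 0 := by
    intro j hj i hi
    have hsq : v j * v j = 1 := by rcases hv1 j with h | h | h <;> simp_all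
    have h : ∑ i, c i * (1 - v j * capPoints i j) = 0 := by
      have : ∑ i, c i * (1 - v j * capPoints i j) =
          ∑ i, c i - v j * ∑ i, c i * capPoints i j := by
        rw [mul_sum, ← sum_sub_distrib]
        exact sum_congr rfl fun i _ => by ring
      rw [this, hsum, hv]
      linear_combination -n * hsq
    have hnn : ∀ i ∈ univ, 0 ≤ c i * (1 - v j * capPoints i j) := by
      intro i _
      refine mul_nonneg (h0 i) ?_
      rcases hv1 j with h | h | h <;> rcases capPoints_mem i j with h' | h' | h' <;> simp [h, h']
    rcases mul_eq_zero.1 ((sum_eq_zero_iff_of_nonneg hnn).1 h i (mem_univ i)) with h | h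
    · exact h
    · exact absurd (by linear_combination -v j * h - capPoints i j * hsq) hi
  have hodd : ¬ (2 : ℤ) ∣ ∑ j, v j := by
    have h₁ : (2 : ℤ) ∣ ∑ i, c i * (∑ j, capPoints i j - 1) :=
      dvd_sum fun i _ => (two_dvd_sum_capPoints_sub_one i).mul_left _
    have h₂ : ∑ i, c i * (∑ j, capPoints i j - 1) = n * (∑ j, v j - 1) := by
      simp_rw [mul_sub, mul_one, sum_sub_distrib, hsum, mul_sum]
      rw [sum_comm, sum_congr rfl fun j _ => hv j]
    rw [h₂] at h₁
    have := (Int.prime_two.dvd_mul.1 h₁).resolve_left hn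
    omega
  obtain ⟨k, hk | ⟨hk, hk'⟩⟩ := exists_unique_coordinate hv1 hodd
  · obtain ⟨i, hi⟩ : ∃ i, c i ≠ 0 := by
      by_contra! h
      simp [h] at hsum
      omega
    have hi' : ∀ j, j ≠ k → capPoints i j = v j := fun j hj => by
      by_contra h
      exact hi (hface j (hk j hj) i h)
    refine (hc i).ne ?_
    rw [← hsum]
    refine (Fintype.sum_eq_single i fun i' hne => ?_).symm
    by_contra h
    refine hne (capPoints_eq_of_eq_off i i' k (fun j hj => ?_) fun j hj => ?_).symm
    · rw [hi' j hj]
      exact hk j hj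
    · rw [hi' j hj]
      by_contra h'
      exact h (hface j (hk j hj) i' (Ne.symm h'))
  · have hk1 : v k = -1 ∨ v k = 1 := by
      have := hv1 k
      omega
    have hz := hface k hk
    have hs : ∀ j, j ≠ k → ∑ i, c i * capPoints i j = 0 := fun j hj => by
      rw [hv, hk' j hj, mul_zero]
    clear hface hv hodd hv1 hk' hk habs
    rcases hk1 with h | h <;> rw [h] at hz <;> fin_cases k <;>
      simp [Fin.forall_fin_succ, Fin.sum_univ_succ, capPoints] at hs hz hsum h0 hc
    all_goals omega

/-- The differences of the cap points with the first one, each taken `n - 1` times. -/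
def capSequence (n : ℕ) : Multiset (Fin 4 → ℤ) :=
  ((n - 1) • (univ.erase (0 : Fin 20)).val).map fun i => capPoints i - capPoints 0

theorem card_capSequence (n : ℕ) : Multiset.card (capSequence n) = 19 * (n - 1) := by
  rw [capSequence, Multiset.card_map, Multiset.card_nsmul, Finset.card_val, mul_comm]
  rfl

theorem not_hasShortZeroSumMod_capSequence {n : ℕ} (hn : ¬ 2 ∣ n) :
    ¬ HasShortZeroSumMod n (capSequence n) := by
  rintro ⟨T, hT, h₁, h₂, h₃⟩
  obtain ⟨T, hTS, rfl⟩ := Multiset.exists_le_map_eq hT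
  rw [Multiset.card_map] at h₂
  have hT0 : 0 < Multiset.card T := by
    rw [Multiset.card_pos]
    rintro rfl
    exact h₁ rfl
  have hcount : ∀ i, T.count i ≤ (n - 1) * (univ.erase (0 : Fin 20)).val.count i := fun i => by
    rw [← Multiset.count_nsmul]
    exact Multiset.count_le_of_le i hTS
  have hcount0 : T.count 0 = 0 := by
    have := hcount 0
    rwa [(Multiset.count_eq_zero (s := (univ.erase (0 : Fin 20)).val)).2 (notMem_erase _ _),
      mul_zero, Nat.le_zero] at this
  have hle : ∀ i, T.count i < n := fun i => by
    have h := Multiset.nodup_iff_count_le_one.1 (univ.erase (0 : Fin 20)).nodup i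
    have := (hcount i).trans (Nat.mul_le_mul_left _ h)
    omega
  have hsumcount : ∑ i, (T.count i : ℤ) = Multiset.card T := by
    rw [← Nat.cast_sum, Multiset.sum_count_eq_card fun i _ => mem_univ i]
  have hsum : ∀ j, (T.map fun i => capPoints i - capPoints 0).sum j =
      ∑ i, (T.count i : ℤ) * capPoints i j - Multiset.card T * capPoints 0 j := fun j => by
    rw [← hsumcount, sum_mul, ← sum_sub_distrib, Finset.sum_multiset_map_count,
      Finset.sum_apply, sum_subset (subset_univ _) fun i _ hi => ?_]
    · exact sum_congr rfl fun i _ => by simp [mul_sub]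
    · rw [Multiset.count_eq_zero_of_notMem (by simpa using hi), zero_smul, Pi.zero_apply]
  refine capPoints_no_lattice_average (n := n) (by exact_mod_cast hn)
    (c := fun i => (T.count i : ℤ) + if i = 0 then (n : ℤ) - Multiset.card T else 0)
    (fun i => ?_) (fun i => ?_) ?_ fun j => ?_
  · split_ifs <;> omega
  · have := hle i
    split_ifs with h
    · subst h
      omega
    · omega
  · rw [sum_add_distrib, hsumcount]
    simp
  · have h : ∑ i, ((T.count i : ℤ) + if i = 0 then (n : ℤ) - Multiset.card T else 0) *
        capPoints i j = n * capPoints 0 j + (T.map fun i => capPoints i - capPoints 0).sum j := by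
      simp only [add_mul, sum_add_distrib, ite_mul, zero_mul, sum_ite_eq', mem_univ, if_true, hsum]
      ring
    rw [h]
    exact dvd_add (dvd_mul_right _ _) (h₃ j)

theorem exists_map_reduceMod_eq (n : ℕ) (S : Multiset (Fin 4 → ZMod n)) :
    ∃ S' : Multiset (Fin 4 → ℤ), S'.map (reduceMod n) = S :=
  Multiset.map_surjective_of_surjective (reduceMod_surjective n) S

theorem lt_etaConst {G : Type*} [AddCommGroup G] {d : ℕ}
    (hd : ∀ S : Multiset G, d ≤ Multiset.card S → HasShortZeroSumSubseq S) {S : Multiset G}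
    (hS : ¬ HasShortZeroSumSubseq S) : Multiset.card S < etaConst G := by
  by_contra! h
  exact hS (Nat.sInf_mem (s := {d | ∀ S : Multiset G, d ≤ Multiset.card S →
    HasShortZeroSumSubseq S}) ⟨d, hd⟩ S h)

theorem davenport_le_of_zero_sum {G : Type*} [AddCommGroup G] {t : ℕ}
    (ht : AddMonoid.exponent G < t + 1)
    (h : ∀ S : Multiset G, Multiset.card S = t + 1 → S.sum = 0 → HasShortZeroSumSubseq S) :
    davenport G ≤ t := by
  classical
  refine Nat.sInf_le fun S hS => ?_
  obtain ⟨S', hS'⟩ := Multiset.card_pos_iff_exists_mem.1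
    ((Multiset.card_powersetCard t S).symm ▸ Nat.choose_pos hS)
  obtain ⟨hS', hcard⟩ := Multiset.mem_powersetCard.1 hS'
  obtain ⟨T, hT, h₀, h₁, h₂⟩ := h (-S'.sum ::ₘ S') (by rw [Multiset.card_cons, hcard]) (by simp)
  by_cases hmem : T ≤ S'
  · exact ⟨T, hmem.trans hS', Multiset.card_pos.1 h₁, h₀⟩
  · obtain ⟨U, hU⟩ := Multiset.le_iff_exists_add.1 hT
    have hUS : U ≤ S' := by
      have hx : -S'.sum ∈ T := by
        by_contra hx
        exact hmem ((Multiset.le_cons_of_notMem hx).1 hT)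
      obtain ⟨V, rfl⟩ := Multiset.exists_cons_of_mem hx
      rw [Multiset.cons_add, Multiset.cons_inj_right] at hU
      exact hU ▸ Multiset.le_add_left _ _
    have hcU := congrArg Multiset.card hU
    have hsU := congrArg Multiset.sum hU
    rw [Multiset.card_cons, Multiset.card_add, hcard] at hcU
    rw [Multiset.sum_cons, Multiset.sum_add, h₀, neg_add_cancel, zero_add] at hsU
    exact ⟨U, hUS.trans hS', Multiset.card_pos.1 (by omega), hsU.symm⟩

theorem stmt_3 (a : ℕ) (ha : 1 ≤ a) :
    (C0 (Fin 4 → ZMod (3 ^ a))).Nonempty := by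
  have h3 : 3 ≤ 3 ^ a := Nat.le_self_pow (by omega) 3
  have hzero : ∀ S : Multiset (Fin 4 → ZMod (3 ^ a)), Multiset.card S = 19 * (3 ^ a - 1) →
      S.sum = 0 → HasShortZeroSumSubseq S := by
    intro S hS h₀
    obtain ⟨S, rfl⟩ := exists_map_reduceMod_eq _ S
    rw [← map_multiset_sum, reduceMod_eq_zero] at h₀
    rw [Multiset.card_map] at hS
    exact hasShort_map_reduceMod.2 (hasShortZeroSumMod_of_card_eq ha (by omega) h₀)
  refine ⟨19 * (3 ^ a - 1), ?_, ?_, hzero⟩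
  · have := davenport_le_of_zero_sum (G := Fin 4 → ZMod (3 ^ a)) (t := 19 * (3 ^ a - 1) - 1)
      (by rw [exponent_fin_four_zmod]; omega) fun S hS => hzero S (by omega)
    omega
  · have hlt := lt_etaConst (d := 19 * 3 ^ a - 18) (fun S hS => ?_) (mt hasShort_map_reduceMod.1
      (not_hasShortZeroSumMod_capSequence (n := 3 ^ a) fun h =>
        absurd (Nat.prime_two.dvd_of_dvd_pow h) (by norm_num)))
    · rw [Multiset.card_map, card_capSequence] at hlt
      omega
    · obtain ⟨S, rfl⟩ := exists_map_reduceMod_eq _ S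
      rw [Multiset.card_map] at hS
      exact hasShort_map_reduceMod.2 (hasShortZeroSumMod_of_card_ge a (by omega))
end

section
/- Let p be a prime, let H be a finite abelian p-group with |H| ≥ 3, let n, m be positive integers with p^n ≥ D(H) and p^n m ≥ 3, and let G = C_{p^n m} ⊕ H. Then C_0(G) is nonempty. -/
/-- Every sequence over `G` of length at least `d` has a nonempty zero-sum subsequence. -/
def DavenportLE (G : Type*) [AddCommGroup G] (d : ℕ) : Prop :=
  ∀ S : Multiset G, d ≤ Multiset.card S → ∃ T, T ≤ S ∧ T ≠ 0 ∧ T.sum = 0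

theorem Multiset.exists_le_map_eq_of_le_map {α β : Type*} (f : α → β) (S : Multiset α) :
    ∀ T ≤ S.map f, ∃ U ≤ S, U.map f = T := by
  classical
  induction S using Multiset.induction with
  | empty => intro T hT; exact ⟨0, le_rfl, by simpa using (Multiset.le_zero.1 hT).symm⟩
  | cons a S ih =>
    intro T hT
    rw [Multiset.map_cons] at hT
    by_cases ha : f a ∈ T
    · obtain ⟨T', rfl⟩ := Multiset.exists_cons_of_mem ha
      obtain ⟨U, hU, rfl⟩ := ih T' ((Multiset.cons_le_cons_iff _).1 hT)
      exact ⟨a ::ₘ U, (Multiset.cons_le_cons_iff _).2 hU, Multiset.map_cons _ _ _⟩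
    · obtain ⟨U, hU, rfl⟩ := ih T ((Multiset.le_cons_of_notMem ha).1 hT)
      exact ⟨U, hU.trans (Multiset.le_cons_self _ _), rfl⟩

theorem Multiset.exists_le_card_eq {α : Type*} {S : Multiset α} {k : ℕ}
    (h : k ≤ Multiset.card S) : ∃ U ≤ S, Multiset.card U = k := by
  induction S using Quotient.inductionOn with
  | _ l =>
    refine ⟨(l.take k : List α), Multiset.coe_le.2 (List.take_sublist k l).subperm, ?_⟩
    simpa using h

theorem davenportLE_natCard (G : Type*) [AddCommGroup G] [Finite G] :
    DavenportLE G (Nat.card G) := by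
  classical
  have := Fintype.ofFinite G
  intro S hS
  induction S using Quotient.inductionOn with
  | _ l =>
    simp only [Multiset.quot_mk_to_coe, Multiset.coe_card] at hS ⊢
    have hlt : Fintype.card G < Fintype.card (Fin (l.length + 1)) := by
      rw [Fintype.card_fin, ← Nat.card_eq_fintype_card]; omega
    obtain ⟨i, j, hij, h⟩ := Fintype.exists_ne_map_eq_of_card_lt
      (fun i : Fin (l.length + 1) => (l.take i).sum) hlt
    wlog hlt' : i < j generalizing i j
    · exact this j i hij.symm h.symm (lt_of_le_of_ne (not_lt.1 hlt') hij.symm)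
    have hsum : (l.take i).sum + ((l.take j).drop i).sum = (l.take j).sum := by
      rw [← List.sum_append]
      congr 1
      conv_rhs => rw [← List.take_append_drop i (l.take j)]
      rw [List.take_take, min_eq_left (show (i : ℕ) ≤ j from hlt'.le)]
    refine ⟨((l.take j).drop i : List G), ?_, ?_, ?_⟩
    · exact Multiset.coe_le.2 ((List.drop_sublist _ _).trans (List.take_sublist _ _)).subperm
    · intro h0
      have := congrArg Multiset.card h0
      simp at this
      have := j.2
      have : (i : ℕ) < j := hlt'
      omega
    · rw [Multiset.sum_coe]
      rw [← h] at hsum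
      simpa using hsum

theorem davenportLE_davenport (G : Type*) [AddCommGroup G] [Finite G] :
    DavenportLE G (davenport G) :=
  Nat.sInf_mem (s := {d | DavenportLE G d}) ⟨_, davenportLE_natCard G⟩

theorem davenport_le {G : Type*} [AddCommGroup G] {d : ℕ} (h : DavenportLE G d) :
    davenport G ≤ d :=
  Nat.sInf_le (s := {d | DavenportLE G d}) h

/-- A zero-sum free sequence is shorter than the Davenport constant. -/
theorem card_lt_davenport {G : Type*} [AddCommGroup G] [Finite G] {S : Multiset G}
    (h : ∀ T ≤ S, T.sum = 0 → T = 0) : Multiset.card S < davenport G := by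
  by_contra! hS
  obtain ⟨T, hT, hT0, hs⟩ := davenportLE_davenport G S hS
  exact hT0 (h T hT hs)

theorem exists_zeroSumFree_card_eq {G : Type*} [AddCommGroup G] {k : ℕ} (hk : k < davenport G) :
    ∃ S : Multiset G, Multiset.card S = k ∧ ∀ T ≤ S, T.sum = 0 → T = 0 := by
  have : ¬ DavenportLE G k := fun h => hk.not_ge (davenport_le h)
  simp only [DavenportLE, not_forall] at this
  obtain ⟨S, hS, hfree⟩ := this
  obtain ⟨U, hU, hUk⟩ := Multiset.exists_le_card_eq hS
  refine ⟨U, hUk, fun T hT hs => ?_⟩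
  by_contra h0
  exact hfree ⟨T, hT.trans hU, h0, hs⟩

theorem three_le_davenport (G : Type*) [AddCommGroup G] [Fintype G] (hG : 3 ≤ Fintype.card G) :
    3 ≤ davenport G := by
  classical
  obtain ⟨a, b, c, hab, hac, hbc⟩ := Fintype.two_lt_card_iff.1 hG
  obtain ⟨g, hg⟩ : ∃ g : G, g ≠ 0 := by
    by_cases h : a = 0
    · exact ⟨b, fun hb => hab (h.trans hb.symm)⟩
    · exact ⟨a, h⟩
  obtain ⟨h, hh0, hhg⟩ : ∃ h : G, h ≠ 0 ∧ g + h ≠ 0 := by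
    have : (({0, -g} : Finset G)ᶜ).Nonempty := by
      rw [← Finset.card_pos, Finset.card_compl]
      have := Finset.card_le_two (a := (0 : G)) (b := -g)
      omega
    obtain ⟨h, hh⟩ := this
    simp only [Finset.mem_compl, Finset.mem_insert, Finset.mem_singleton, not_or] at hh
    exact ⟨h, hh.1, fun e => hh.2 (neg_eq_of_add_eq_zero_right e).symm⟩
  refine card_lt_davenport (S := {g, h}) fun T hT hs => ?_
  have hT' : T ∈ Multiset.powerset {g, h} := Multiset.mem_powerset.2 hT
  simp only [Multiset.insert_eq_cons, Multiset.powerset_cons, Multiset.powerset_zero,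
    ← Multiset.cons_zero, Multiset.map_cons, Multiset.map_zero] at hT'
  simp at hT'
  rcases hT' with rfl | rfl | rfl | rfl <;> simp_all

theorem hasShortZeroSumSubseq_of_card {G : Type*} [AddCommGroup G] [Finite G] (S : Multiset G)
    (hS : Nat.card G * AddMonoid.exponent G ≤ Multiset.card S) : HasShortZeroSumSubseq S := by
  classical
  have := Fintype.ofFinite G
  have hpos : 0 < AddMonoid.exponent G := AddMonoid.exponent_pos_of_exists _
    (Nat.card_pos (α := G)) fun g => by rw [Nat.card_eq_fintype_card]; exact card_nsmul_eq_zero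
  obtain ⟨g, hg⟩ : ∃ g, AddMonoid.exponent G ≤ S.count g := by
    by_contra! h
    have h1 : ∑ g : G, S.count g = Multiset.card S :=
      Multiset.sum_count_eq_card fun a _ => Finset.mem_univ a
    have h2 : ∑ g : G, S.count g < ∑ _g : G, AddMonoid.exponent G :=
      Finset.sum_lt_sum_of_nonempty ⟨0, Finset.mem_univ _⟩ fun g _ => h g
    rw [Finset.sum_const, Finset.card_univ, ← Nat.card_eq_fintype_card, smul_eq_mul] at h2
    omega
  refine ⟨Multiset.replicate (AddMonoid.exponent G) g, Multiset.le_count_iff_replicate_le.1 hg,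
    ?_, ?_, ?_⟩
  · rw [Multiset.sum_replicate, AddMonoid.exponent_nsmul_eq_zero]
  · simpa using Nat.one_le_of_lt hpos
  · simp

/-- A sequence without short zero-sum subsequence is shorter than `η(G)`. -/
theorem card_lt_etaConst {G : Type*} [AddCommGroup G] [Finite G] {S : Multiset G}
    (h : ¬ HasShortZeroSumSubseq S) : Multiset.card S < etaConst G := by
  by_contra! hS
  exact h (Nat.sInf_mem (s := {d : ℕ | ∀ S : Multiset G, d ≤ Multiset.card S →
    HasShortZeroSumSubseq S}) ⟨_, hasShortZeroSumSubseq_of_card⟩ S hS)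

section GroupRing

open AddMonoidAlgebra

variable {G : Type*} [AddCommGroup G] {R : Type*} [CommRing R]

theorem coeff_prod_one_sub_single_cons (a : G) (S : Multiset G) (h : G) :
    (((a ::ₘ S).map fun g => 1 - single g (1 : R)).prod).coeff h =
      ((S.map fun g => 1 - single g (1 : R)).prod).coeff h -
      ((S.map fun g => 1 - single g (1 : R)).prod).coeff (-a + h) := by
  rw [Multiset.map_cons, Multiset.prod_cons, sub_mul, one_mul, coeff_sub, Finsupp.sub_apply,
    coeff_single_mul_apply, one_mul]

theorem exists_sum_eq_of_coeff_prod_ne_zero (S : Multiset G) :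
    ∀ h : G, ((S.map fun g => 1 - single g (1 : R)).prod).coeff h ≠ 0 →
      ∃ T ≤ S, T.sum = h := by
  induction S using Multiset.induction with
  | empty =>
    intro h hh
    refine ⟨0, le_rfl, ?_⟩
    by_contra h0
    apply hh
    rw [Multiset.map_zero, Multiset.prod_zero, one_def, coeff_single,
      Finsupp.single_eq_of_ne]
    simpa [eq_comm] using h0
  | cons a S ih =>
    intro h hh
    rw [coeff_prod_one_sub_single_cons] at hh
    by_cases h1 : ((S.map fun g => 1 - single g (1 : R)).prod).coeff h = 0
    · obtain ⟨T, hT, hs⟩ := ih (-a + h) fun h2 => hh (by rw [h1, h2, sub_zero])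
      exact ⟨a ::ₘ T, (Multiset.cons_le_cons_iff _).2 hT, by rw [Multiset.sum_cons, hs]; abel⟩
    · obtain ⟨T, hT, hs⟩ := ih h h1
      exact ⟨T, hT.trans (Multiset.le_cons_self _ _), hs⟩

theorem coeff_prod_zero_of_zeroSumFree (S : Multiset G) (hS : ∀ T ≤ S, T.sum = 0 → T = 0) :
    ((S.map fun g => 1 - single g (1 : R)).prod).coeff 0 = 1 := by
  induction S using Multiset.induction with
  | empty => simp [one_def]
  | cons a S ih =>
    rw [coeff_prod_one_sub_single_cons,
      ih fun T hT => hS T (hT.trans (Multiset.le_cons_self _ _)), sub_eq_self]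
    by_contra h
    obtain ⟨T, hT, hs⟩ := exists_sum_eq_of_coeff_prod_ne_zero S _ h
    have := hS (a ::ₘ T) ((Multiset.cons_le_cons_iff _).2 hT) (by rw [Multiset.sum_cons, hs]; abel)
    exact Multiset.cons_ne_zero this

theorem one_sub_single_mem_of_closure_eq_top {I : Ideal (AddMonoidAlgebra R G)} {s : Set G}
    (hs : AddSubgroup.closure s = ⊤) (hI : ∀ g ∈ s, 1 - single g (1 : R) ∈ I) (g : G) :
    1 - single g (1 : R) ∈ I := by
  have hg : g ∈ AddSubgroup.closure s := hs ▸ AddSubgroup.mem_top g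
  induction hg using AddSubgroup.closure_induction with
  | mem x hx => exact hI x hx
  | zero => rw [← one_def, sub_self]; exact I.zero_mem
  | add x y _ _ hx hy =>
    have h : 1 - single (x + y) (1 : R) =
        (1 - single x 1) + single x 1 * (1 - single y 1) := by
      rw [mul_sub, single_mul_single, mul_one, mul_one]; abel
    rw [h]
    exact I.add_mem hx (I.mul_mem_left _ hy)
  | neg x _ hx =>
    have h : 1 - single (-x) (1 : R) = -(single (-x) 1 * (1 - single x 1)) := by
      rw [mul_sub, single_mul_single, mul_one, mul_one, neg_add_cancel, ← one_def]; abel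
    rw [h]
    exact I.neg_mem (I.mul_mem_left _ hx)

end GroupRing

theorem Finset.sum_pow_eq_zero_of_pow_eq_zero {R ι : Type*} [CommSemiring R] (s : Finset ι)
    (x : ι → R) (k : ι → ℕ) (h : ∀ i ∈ s, x i ^ (k i + 1) = 0) :
    (∑ i ∈ s, x i) ^ (∑ i ∈ s, k i + 1) = 0 := by
  classical
  induction s using Finset.induction with
  | empty => simp
  | insert a s ha ih =>
    rw [Finset.sum_insert ha, Finset.sum_insert ha]
    refine (Commute.all _ _).add_pow_eq_zero_of_add_le_succ_of_pow_eq_zero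
      (h a (Finset.mem_insert_self a s)) (ih fun i hi => h i (Finset.mem_insert_of_mem hi)) ?_
    omega

theorem Multiset.prod_mem_ideal_pow {R : Type*} [CommSemiring R] (I : Ideal R) (S : Multiset R)
    (h : ∀ x ∈ S, x ∈ I) : S.prod ∈ I ^ Multiset.card S := by
  induction S using Multiset.induction with
  | empty => simp
  | cons a S ih =>
    rw [Multiset.prod_cons, Multiset.card_cons, pow_succ']
    exact Ideal.mul_mem_mul (h a (Multiset.mem_cons_self a S))
      (ih fun x hx => h x (Multiset.mem_cons_of_mem hx))

/-- Olson's upper bound for the Davenport constant of a finite abelian `p`-group. -/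
theorem davenportLE_of_closure_range_eq_top {G ι : Type*} [AddCommGroup G] [Fintype ι] {p : ℕ}
    (hp : p.Prime) (g : ι → G) (e : ι → ℕ) (hg : AddSubgroup.closure (Set.range g) = ⊤)
    (he : ∀ i, p ^ e i • g i = 0) : DavenportLE G (∑ i, (p ^ e i - 1) + 1) := by
  have : Fact p.Prime := ⟨hp⟩
  intro S hS
  by_contra! hfree
  have hone := coeff_prod_zero_of_zeroSumFree (R := ZMod p) S
    fun T hT hs => by_contra fun h0 => hfree T hT h0 hs
  set y : ι → AddMonoidAlgebra (ZMod p) G := fun i => 1 - AddMonoidAlgebra.single (g i) 1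
  set I : Ideal (AddMonoidAlgebra (ZMod p) G) := ∑ i, Ideal.span {y i} with hIdef
  have hyI : ∀ i, y i ∈ I := fun i =>
    (Finset.single_le_sum (f := fun i => Ideal.span {y i}) (fun _ _ => bot_le)
      (Finset.mem_univ i)) (Ideal.mem_span_singleton_self _)
  have hy : ∀ i, y i ^ p ^ e i = 0 := fun i => by
    have : CharP (AddMonoidAlgebra (ZMod p) G) p := charP_of_injective_algebraMap
      (FaithfulSMul.algebraMap_injective (ZMod p) (AddMonoidAlgebra (ZMod p) G)) p
    rw [sub_pow_char_pow, one_pow, AddMonoidAlgebra.single_pow, he, one_pow,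
      ← AddMonoidAlgebra.one_def, sub_self]
  have hI : I ^ (∑ i, (p ^ e i - 1) + 1) = 0 := by
    refine Finset.sum_pow_eq_zero_of_pow_eq_zero _ _ _ fun i _ => ?_
    rw [Nat.sub_add_cancel (Nat.one_le_pow _ _ hp.pos), Ideal.span_singleton_pow, hy]
    simp
  have hmem := Multiset.prod_mem_ideal_pow I
    (S.map fun h => 1 - AddMonoidAlgebra.single h (1 : ZMod p)) fun x hx => by
      obtain ⟨h, -, rfl⟩ := Multiset.mem_map.1 hx
      refine one_sub_single_mem_of_closure_eq_top hg ?_ h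
      rintro _ ⟨i, rfl⟩
      exact hyI i
  rw [Multiset.card_map] at hmem
  have h0 := Ideal.pow_le_pow_right hS hmem
  rw [hI] at h0
  rw [show _ = (0 : AddMonoidAlgebra (ZMod p) G) from h0] at hone
  simp at hone

theorem exists_generators_sum_lt_davenport {p : ℕ} (hp : p.Prime) (H : Type*) [AddCommGroup H]
    [Finite H] (hH : ∃ k : ℕ, Nat.card H = p ^ k) :
    ∃ (ι : Type) (_ : Fintype ι) (g : ι → H) (e : ι → ℕ),
      AddSubgroup.closure (Set.range g) = ⊤ ∧ (∀ i, p ^ e i • g i = 0) ∧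
      ∑ i, (p ^ e i - 1) < davenport H := by
  classical
  obtain ⟨ι, hι, n, hn, ⟨φ⟩⟩ := AddCommGroup.equiv_directSum_zmod_of_finite' H
  obtain ⟨k, hk⟩ := hH
  set g : ι → H := fun i => φ.symm (DirectSum.of (fun i => ZMod (n i)) i 1) with hg
  have hφg : ∀ i, φ (g i) = DirectSum.of (fun i => ZMod (n i)) i 1 := fun i =>
    φ.apply_symm_apply _
  have hord : ∀ i, addOrderOf (g i) = n i := fun i => by
    rw [← addOrderOf_injective φ.toAddMonoidHom φ.injective, AddEquiv.toAddMonoidHom_eq_coe,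
      AddMonoidHom.coe_coe, hφg, addOrderOf_injective _ (DirectSum.of_injective i),
      ZMod.addOrderOf_one]
  have hpow : ∀ i, ∃ e, n i = p ^ e := fun i => by
    have h := addOrderOf_dvd_natCard (g i)
    rw [hord, hk, Nat.dvd_prime_pow hp] at h
    exact h.imp fun _ h => h.2
  choose e he using hpow
  refine ⟨ι, hι, g, e, ?_, fun i => ?_, ?_⟩
  · refine eq_top_iff.2 fun x _ => ?_
    obtain ⟨x, rfl⟩ := φ.symm.surjective x
    induction x using DirectSum.induction_on with
    | zero => rw [map_zero]; exact zero_mem _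
    | of i z =>
      obtain ⟨z, rfl⟩ := ZMod.intCast_surjective z
      rw [← zsmul_one, map_zsmul, map_zsmul]
      exact zsmul_mem (AddSubgroup.subset_closure (Set.mem_range_self i)) z
    | add x y hx hy => rw [map_add]; exact add_mem (hx trivial) (hy trivial)
  · rw [← he, ← hord i, addOrderOf_nsmul_eq_zero]
  · set S : Multiset H := ∑ i, Multiset.replicate (n i - 1) (g i) with hS
    have hcard : Multiset.card S = ∑ i, (p ^ e i - 1) := by
      simp [hS, he]
    have hmem : ∀ x ∈ S, ∃ i, x = g i := fun x hx => by
      obtain ⟨i, -, hi⟩ := Multiset.mem_sum.1 hx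
      exact ⟨i, Multiset.eq_of_mem_replicate hi⟩
    have hinj : Function.Injective g := fun i j hij => by
      by_contra hne
      have : Nontrivial (ZMod (n j)) := ZMod.nontrivial_iff.2 (hn j).ne'
      have h := congrArg (fun x => φ x j) hij
      simp only [hφg] at h
      rw [DirectSum.of_eq_same, DirectSum.of_eq_of_ne _ _ _ (Ne.symm hne)] at h
      exact zero_ne_one h
    have hcount : ∀ i, S.count (g i) = n i - 1 := fun i => by
      rw [hS, Multiset.count_sum', Finset.sum_eq_single i]
      · rw [Multiset.count_replicate_self]
      · intro j _ hj
        rw [Multiset.count_replicate, if_neg fun h => hj (hinj h)]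
      · simp
    rw [← hcard]
    refine card_lt_davenport fun T hT hs => ?_
    by_contra h0
    obtain ⟨x, hx⟩ := Multiset.exists_mem_of_ne_zero h0
    obtain ⟨i, rfl⟩ := hmem x (Multiset.mem_of_le hT hx)
    have hsum : ∀ U : Multiset H, (∀ x ∈ U, ∃ i, x = g i) →
        φ U.sum i = (U.count (g i) : ZMod (n i)) := by
      intro U
      induction U using Multiset.induction with
      | empty => simp
      | cons a U ih =>
        intro hU
        obtain ⟨j, rfl⟩ := hU a (Multiset.mem_cons_self _ _)
        rw [Multiset.sum_cons, map_add, DirectSum.add_apply, hφg,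
          ih fun x hx => hU x (Multiset.mem_cons_of_mem hx), Multiset.count_cons]
        by_cases hij : i = j
        · subst hij
          simp [add_comm]
        · rw [DirectSum.of_eq_of_ne _ _ _ hij, if_neg fun h => hij (hinj h)]
          simp
    have h := hsum T fun x hx => hmem x (Multiset.mem_of_le hT hx)
    rw [hs, map_zero, DirectSum.zero_apply, eq_comm, ZMod.natCast_eq_zero_iff] at h
    have h1 := Nat.le_of_dvd (Multiset.count_pos.2 hx) h
    have h2 := Multiset.count_le_of_le (g i) hT
    have h3 := hn i
    rw [hcount] at h2
    omega

theorem closure_range_option_eq_top {H ι : Type*} [AddCommGroup H] (N : ℕ) (g : ι → H)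
    (hg : AddSubgroup.closure (Set.range g) = ⊤) :
    AddSubgroup.closure (Set.range fun i : Option ι =>
      i.elim ((1 : ZMod N), (0 : H)) fun i => (0, g i)) = ⊤ := by
  set K := AddSubgroup.closure (Set.range fun i : Option ι =>
      i.elim ((1 : ZMod N), (0 : H)) fun i => (0, g i))
  refine eq_top_iff.2 fun x _ => ?_
  have h1 : (x.1, (0 : H)) ∈ K := by
    obtain ⟨z, hz⟩ := ZMod.intCast_surjective x.1
    have : (x.1, (0 : H)) = z • ((1 : ZMod N), (0 : H)) := by simp [← hz]
    rw [this]
    exact zsmul_mem (AddSubgroup.subset_closure (Set.mem_range.2 ⟨none, rfl⟩)) z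
  have h2 : ((0 : ZMod N), x.2) ∈ K := by
    have : AddSubgroup.closure (Set.range g) ≤ K.comap (AddMonoidHom.inr (ZMod N) H) := by
      rw [AddSubgroup.closure_le]
      rintro _ ⟨i, rfl⟩
      exact AddSubgroup.subset_closure ⟨some i, rfl⟩
    exact this (hg ▸ AddSubgroup.mem_top x.2)
  have := add_mem h1 h2
  simpa using this

/-- The Davenport constants of `C_q ⊕ H` and `C_q ⊕ C_q ⊕ H`, for a `p`-group `H` and a power `q`
of `p`. -/
theorem davenportLE_zmod_prod {p : ℕ} (hp : p.Prime) (H : Type*) [AddCommGroup H]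
    [Finite H] (hH : ∃ k : ℕ, Nat.card H = p ^ k) (n : ℕ) :
    DavenportLE (ZMod (p ^ n) × H) (p ^ n - 1 + davenport H) ∧
    DavenportLE (ZMod (p ^ n) × ZMod (p ^ n) × H) (2 * (p ^ n - 1) + davenport H) := by
  obtain ⟨ι, _, g, e, hg, he, hlt⟩ := exists_generators_sum_lt_davenport hp H hH
  have hg1 := closure_range_option_eq_top (p ^ n) g hg
  have hg2 := closure_range_option_eq_top (p ^ n) _ hg1
  have h1 := davenportLE_of_closure_range_eq_top hp _ (fun i : Option ι => i.elim n e) hg1 <| by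
    rintro (_ | i) <;> simp [he]
  have h2 := davenportLE_of_closure_range_eq_top hp _
    (fun i : Option (Option ι) => i.elim n fun i => i.elim n e) hg2 <| by
    rintro (_ | _ | i) <;> simp [he]
  simp only [Fintype.sum_option, Option.elim] at h1 h2
  exact ⟨fun S hS => h1 S (by omega), fun S hS => h2 S (by omega)⟩

theorem exists_short_zeroSum_of_davenportLE {Q : Type*} [AddCommGroup Q] {q d : ℕ} (hq : 0 < q)
    (hdq : d < 2 * q) (hd : DavenportLE Q d) (hd' : DavenportLE (ZMod q × Q) (q + d))
    (S : Multiset Q) (hS : q + d ≤ Multiset.card S) :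
    ∃ T ≤ S, T ≠ 0 ∧ T.sum = 0 ∧ Multiset.card T ≤ q := by
  classical
  obtain ⟨U, hU, hUc⟩ := Multiset.exists_le_card_eq hS
  obtain ⟨V, hV, hV0, hVs⟩ := hd' (U.map fun x => ((1 : ZMod q), x)) (by simp [hUc])
  obtain ⟨T, hT, rfl⟩ := Multiset.exists_le_map_eq_of_le_map _ _ _ hV
  have hT0 : T ≠ 0 := fun h => hV0 (by simp [h])
  have h1 : (Multiset.card T : ZMod q) = 0 := by
    have := congrArg (AddMonoidHom.fst (ZMod q) Q) hVs
    rw [map_multiset_sum, Multiset.map_map] at this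
    simpa using this
  have h2 : T.sum = 0 := by
    have := congrArg (AddMonoidHom.snd (ZMod q) Q) hVs
    rw [map_multiset_sum, Multiset.map_map] at this
    simpa using this
  rw [ZMod.natCast_eq_zero_iff] at h1
  obtain ⟨c, hc⟩ := h1
  have hTc := Multiset.card_le_card hT
  have hTpos := Multiset.card_pos.2 hT0
  by_cases hle : Multiset.card T ≤ q
  · exact ⟨T, hT.trans hU, hT0, h2, hle⟩
  have hc2 : c = 2 := by
    have : c < 3 := by
      by_contra! h
      have := Nat.mul_le_mul_left q h
      omega
    have : c ≠ 0 := by rintro rfl; simp at hc; contradiction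
    have : c ≠ 1 := by rintro rfl; omega
    omega
  subst hc2
  obtain ⟨a, ha⟩ := Multiset.exists_mem_of_ne_zero hT0
  have hac := Multiset.card_erase_of_mem ha
  rw [Nat.pred_eq_sub_one] at hac
  obtain ⟨W, hW, hW0, hWs⟩ := hd (T.erase a) (by omega)
  have hWc := Multiset.card_le_card hW
  have hWT := hW.trans (Multiset.erase_le a T)
  by_cases hWq : Multiset.card W ≤ q
  · exact ⟨W, (hWT.trans hT).trans hU, hW0, hWs, hWq⟩
  have hsub := Multiset.card_sub hWT
  refine ⟨T - W, (Multiset.sub_le_self T W).trans (hT.trans hU), ?_, ?_, by omega⟩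
  · rw [← Multiset.card_pos]; omega
  · have := congrArg Multiset.sum (Multiset.sub_add_cancel hWT)
    rw [Multiset.sum_add, hWs, add_zero] at this
    rw [this, h2]

theorem Multiset.exists_add_eq_of_le_add {α : Type*} {T A B : Multiset α} (h : T ≤ A + B) :
    ∃ U ≤ A, ∃ V ≤ B, U + V = T := by
  classical
  exact ⟨T ∩ A, Multiset.inter_le_right, T - A, tsub_le_iff_left.2 h,
    by rw [add_comm, Multiset.sub_add_inter]⟩

theorem Multiset.sum_le_sum_of_le {α : Type*} {𝒯 𝒰 : Multiset (Multiset α)} (h : 𝒯 ≤ 𝒰) :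
    𝒯.sum ≤ 𝒰.sum := by
  obtain ⟨𝒱, rfl⟩ := Multiset.le_iff_exists_add.1 h
  rw [Multiset.sum_add]
  exact Multiset.le_add_right _ _

/-- The inductive method: a bound on the Davenport constant of `G` from bounds for a quotient
and for the kernel. -/
theorem davenportLE_of_ker {G Q : Type*} [AddCommGroup G] [AddCommGroup Q] (f : G →+ Q)
    {L d m : ℕ} (hL : ∀ S : Multiset Q, L + d ≤ Multiset.card S →
      ∃ T ≤ S, T ≠ 0 ∧ T.sum = 0 ∧ Multiset.card T ≤ L)
    (hd : DavenportLE Q d) (hm : DavenportLE f.ker (m + 1)) :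
    DavenportLE G (L * m + d) := by
  classical
  have key : ∀ k : ℕ, ∀ S : Multiset G, L * k + d ≤ Multiset.card S →
      ∃ 𝒯 : Multiset {T : Multiset G // T ≠ 0 ∧ f T.sum = 0},
        Multiset.card 𝒯 = k + 1 ∧ (𝒯.map Subtype.val).sum ≤ S := by
    intro k
    induction k with
    | zero =>
      intro S hS
      obtain ⟨T, hT, hT0, hTs⟩ := hd (S.map f) (by simpa using hS)
      obtain ⟨T, hTS, rfl⟩ := Multiset.exists_le_map_eq_of_le_map _ _ _ hT
      refine ⟨{⟨T, fun h => hT0 (by simp [h]), by rw [map_multiset_sum, hTs]⟩}, rfl, ?_⟩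
      simp only [Multiset.map_singleton, Multiset.sum_singleton]
      exact hTS
    | succ k ih =>
      intro S hS
      rw [Nat.mul_succ] at hS
      obtain ⟨T, hT, hT0, hTs, hTc⟩ := hL (S.map f) (by rw [Multiset.card_map]; omega)
      obtain ⟨T, hTS, rfl⟩ := Multiset.exists_le_map_eq_of_le_map _ _ _ hT
      rw [Multiset.card_map] at hTc
      have hsub := Multiset.card_sub hTS
      obtain ⟨𝒯, hc, hle⟩ := ih (S - T) (by omega)
      refine ⟨⟨T, fun h => hT0 (by simp [h]), by rw [map_multiset_sum, hTs]⟩ ::ₘ 𝒯,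
        by rw [Multiset.card_cons, hc], ?_⟩
      rw [Multiset.map_cons, Multiset.sum_cons, ← add_tsub_cancel_of_le hTS]
      exact Multiset.add_le_add_left hle
  intro S hS
  obtain ⟨𝒯, hc, hle⟩ := key m S hS
  let σ : {T : Multiset G // T ≠ 0 ∧ f T.sum = 0} → f.ker := fun T => ⟨T.1.sum, T.2.2⟩
  obtain ⟨K, hK, hK0, hKs⟩ := hm (𝒯.map σ) (by simp [hc])
  obtain ⟨𝒰, h𝒰, rfl⟩ := Multiset.exists_le_map_eq_of_le_map _ _ _ hK
  refine ⟨(𝒰.map Subtype.val).sum,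
    (Multiset.sum_le_sum_of_le (Multiset.map_le_map h𝒰)).trans hle, fun h => ?_, ?_⟩
  · obtain ⟨T, hT⟩ := Multiset.exists_mem_of_ne_zero
      (show 𝒰 ≠ 0 from fun h => hK0 (by simp [h]))
    have hle := Multiset.single_le_sum (fun _ _ => Multiset.zero_le _) _
      (Multiset.mem_map_of_mem Subtype.val hT)
    rw [h] at hle
    exact T.2.1 (Multiset.le_zero.1 hle)
  · have := congrArg f.ker.subtype hKs
    rw [map_multiset_sum, Multiset.map_map, map_zero] at this
    have h := map_multiset_sum Multiset.sumAddMonoidHom (𝒰.map Subtype.val)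
    rw [Multiset.map_map] at h
    exact h.trans this

theorem card_ker_castHom_prodMap (q m : ℕ) (hq : 0 < q) (hm : 0 < m) (H : Type*) [AddCommGroup H]
    [Finite H] :
    Nat.card ((ZMod.castHom (Dvd.intro m rfl) (ZMod q) : ZMod (q * m) →+ ZMod q).prodMap
      (AddMonoidHom.id H)).ker = m := by
  have : NeZero q := ⟨hq.ne'⟩
  have : NeZero (q * m) := ⟨(Nat.mul_pos hq hm).ne'⟩
  set f := (ZMod.castHom (Dvd.intro m rfl) (ZMod q) : ZMod (q * m) →+ ZMod q).prodMap
      (AddMonoidHom.id H)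
  have hf : Function.Surjective f :=
    Prod.map_surjective.2 ⟨ZMod.castHom_surjective (Dvd.intro m rfl), Function.surjective_id⟩
  have h := AddSubgroup.card_eq_card_quotient_mul_card_addSubgroup f.ker
  rw [Nat.card_congr (QuotientAddGroup.quotientKerEquivOfSurjective f hf).toEquiv,
    Nat.card_prod, Nat.card_prod, Nat.card_zmod, Nat.card_zmod] at h
  have hpos : 0 < q * Nat.card H := Nat.mul_pos hq Nat.card_pos
  refine Nat.eq_of_mul_eq_mul_left hpos ?_
  rw [← h]; ring

theorem davenportLE_zmod_mul_prod {p : ℕ} (hp : p.Prime) (H : Type*) [AddCommGroup H]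
    [Finite H] (hH : ∃ k : ℕ, Nat.card H = p ^ k) {n m : ℕ} (hm : 0 < m)
    (hpD : davenport H ≤ p ^ n) :
    DavenportLE (ZMod (p ^ n * m) × H) (p ^ n * m - 1 + davenport H) := by
  have hq : 0 < p ^ n := pow_pos hp.pos n
  have : NeZero (p ^ n * m) := ⟨(Nat.mul_pos hq hm).ne'⟩
  obtain ⟨h1, h2⟩ := davenportLE_zmod_prod hp H hH n
  set f := (ZMod.castHom (Dvd.intro m rfl) (ZMod (p ^ n)) : ZMod (p ^ n * m) →+ ZMod (p ^ n)).prodMap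
      (AddMonoidHom.id H)
  have hker : DavenportLE f.ker m := by
    have := davenportLE_natCard f.ker
    rwa [card_ker_castHom_prodMap _ _ hq hm] at this
  obtain ⟨m, rfl⟩ := Nat.exists_eq_succ_of_ne_zero hm.ne'
  have := davenportLE_of_ker f (exists_short_zeroSum_of_davenportLE hq (by omega) h1
    fun S hS => h2 S (by omega)) h1 hker
  intro S hS
  refine this S ?_
  have := Nat.mul_succ (p ^ n) m
  omega

theorem exponent_zmod_prod {p : ℕ} (hp : p.Prime) (H : Type*) [AddCommGroup H]
    [Finite H] (hH : ∃ k : ℕ, Nat.card H = p ^ k) {n m : ℕ} (hpD : davenport H ≤ p ^ n) :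
    AddMonoid.exponent (ZMod (p ^ n * m) × H) = p ^ n * m := by
  rw [AddMonoid.exponent_prod, ZMod.exponent]
  refine Nat.lcm_eq_left (Dvd.dvd.mul_right (AddMonoid.exponent_dvd_iff_forall_nsmul_eq_zero.2
    fun h => ?_) m)
  obtain ⟨k, hk⟩ := hH
  obtain ⟨j, -, hj⟩ := (Nat.dvd_prime_pow hp).1 (hk ▸ addOrderOf_dvd_natCard h)
  obtain ⟨T, hT, hT0, hTs⟩ := davenportLE_davenport H (Multiset.replicate (davenport H) h) (by simp)
  obtain ⟨c, hc, rfl⟩ := Multiset.le_replicate_iff.1 hT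
  rw [Multiset.sum_replicate, ← addOrderOf_dvd_iff_nsmul_eq_zero] at hTs
  have hc0 : 0 < c := Nat.pos_of_ne_zero fun h => hT0 (by simp [h])
  have := (Nat.le_of_dvd hc0 hTs).trans (hc.trans hpD)
  rw [hj] at this
  rw [← addOrderOf_dvd_iff_nsmul_eq_zero, hj]
  exact pow_dvd_pow p ((Nat.pow_le_pow_iff_right hp.one_lt).1 this)

/-- Every zero-sum sequence of length `D(G) + 1` has a short zero-sum subsequence as soon as
`D(G) < 2 exp(G)`. -/
theorem hasShortZeroSumSubseq_of_card_eq_davenport_succ {G : Type*} [AddCommGroup G] [Finite G]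
    (hG : davenport G < 2 * AddMonoid.exponent G) (S : Multiset G)
    (hS : Multiset.card S = davenport G + 1) (hs : S.sum = 0) : HasShortZeroSumSubseq S := by
  classical
  obtain ⟨a, ha⟩ : ∃ a, a ∈ S := Multiset.card_pos_iff_exists_mem.1 (by omega)
  have hac := Multiset.card_erase_of_mem ha
  rw [Nat.pred_eq_sub_one] at hac
  obtain ⟨T, hT, hT0, hTs⟩ := davenportLE_davenport G (S.erase a) (by omega)
  have hTc := Multiset.card_le_card hT
  have hTS := hT.trans (Multiset.erase_le a S)
  have hTpos := Multiset.card_pos.2 hT0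
  by_cases h : Multiset.card T ≤ AddMonoid.exponent G
  · exact ⟨T, hTS, hTs, hTpos, h⟩
  have hsub := Multiset.card_sub hTS
  refine ⟨S - T, Multiset.sub_le_self S T, ?_, by omega, by omega⟩
  have := congrArg Multiset.sum (Multiset.sub_add_cancel hTS)
  rw [Multiset.sum_add, hTs, add_zero] at this
  rw [this, hs]

/-- The sequence made of `(0, x)` and `(1, x)`, for `x` in a zero-sum free sequence over `H`, and
of `(1, 0)` repeated `N - 1` times has no short zero-sum subsequence. -/
theorem lt_etaConst_zmod_prod {N : ℕ} (hN : 0 < N) (H : Type*) [AddCommGroup H] [Finite H]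
    (hexp : AddMonoid.exponent (ZMod N × H) = N) (hD : 0 < davenport H) :
    N - 1 + 2 * (davenport H - 1) < etaConst (ZMod N × H) := by
  classical
  have : NeZero N := ⟨hN.ne'⟩
  obtain ⟨A, hAc, hA⟩ := exists_zeroSumFree_card_eq (G := H) (k := davenport H - 1) (by omega)
  set S : Multiset (ZMod N × H) := A.map (fun x => (0, x)) +
    (A + Multiset.replicate (N - 1) 0).map fun x => (1, x) with hS
  have hcard : Multiset.card S = N - 1 + 2 * (davenport H - 1) := by
    simp [hS, hAc]; omega
  rw [← hcard]
  refine card_lt_etaConst ?_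
  rintro ⟨T, hT, hTs, hT1, hTN⟩
  rw [hexp] at hTN
  obtain ⟨T₀, hT₀, T₁, hT₁, rfl⟩ := Multiset.exists_add_eq_of_le_add hT
  obtain ⟨U, hU, rfl⟩ := Multiset.exists_le_map_eq_of_le_map _ _ _ hT₀
  obtain ⟨V, hV, rfl⟩ := Multiset.exists_le_map_eq_of_le_map _ _ _ hT₁
  obtain ⟨V₀, hV₀, V₁, hV₁, rfl⟩ := Multiset.exists_add_eq_of_le_add hV
  obtain ⟨c, hc, rfl⟩ := Multiset.le_replicate_iff.1 hV₁
  have h1 : ((Multiset.card V₀ + c : ℕ) : ZMod N) = 0 := by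
    have := congrArg (AddMonoidHom.fst (ZMod N) H) hTs
    rw [map_multiset_sum, Multiset.map_add, Multiset.map_map, Multiset.map_map] at this
    simpa using this
  have h2 : U.sum + V₀.sum = 0 := by
    have := congrArg (AddMonoidHom.snd (ZMod N) H) hTs
    rw [map_multiset_sum, Multiset.map_add, Multiset.map_map, Multiset.map_map] at this
    simpa using this
  rw [ZMod.natCast_eq_zero_iff] at h1
  simp only [Multiset.card_add, Multiset.card_map, Multiset.card_replicate] at hT1 hTN
  rcases Nat.eq_zero_or_pos (Multiset.card V₀ + c) with h0 | h0
  · have hV₀0 : V₀ = 0 := Multiset.card_eq_zero.1 (by omega)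
    have hU0 : U = 0 := hA U hU (by simpa [hV₀0] using h2)
    simp only [hU0, Multiset.card_zero] at hT1
    omega
  · have h3 := Nat.le_of_dvd h0 h1
    have hU0 : U = 0 := Multiset.card_eq_zero.1 (by omega)
    have hV₀0 : V₀ = 0 := hA V₀ hV₀ (by simpa [hU0] using h2)
    simp only [hV₀0, Multiset.card_zero] at h3
    omega

theorem stmt_6 (p : ℕ) (hp : p.Prime) (H : Type*) [AddCommGroup H] [Fintype H]
    (hHp : ∃ k : ℕ, Fintype.card H = p ^ k) (hH3 : 3 ≤ Fintype.card H)
    (n m : ℕ) (hn : 0 < n) (hm : 0 < m) (hpD : davenport H ≤ p ^ n)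
    (hpm : 3 ≤ p ^ n * m) :
    (C0 (ZMod (p ^ n * m) × H)).Nonempty := by
  
  have hH : ∃ k : ℕ, Nat.card H = p ^ k := by simpa only [Nat.card_eq_fintype_card] using hHp
  have hN : 0 < p ^ n * m := Nat.mul_pos (pow_pos hp.pos n) hm
  have : NeZero (p ^ n * m) := ⟨hN.ne'⟩
  have hle : p ^ n ≤ p ^ n * m := Nat.le_mul_of_pos_right _ hm
  have hD := davenport_le (davenportLE_zmod_mul_prod hp H hH hm hpD)
  have hexp := exponent_zmod_prod hp H hH (m := m) hpD
  have h3 := three_le_davenport H hH3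
  have heta := lt_etaConst_zmod_prod hN H hexp (by omega)
  exact ⟨davenport (ZMod (p ^ n * m) × H) + 1, le_rfl, by omega,
    hasShortZeroSumSubseq_of_card_eq_davenport_succ (by omega)⟩
end
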